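/- arXiv:2011.10623 — 3 statements merged into one kernel-verified Lean document; each statement's English description precedes it below -/
import Mathlib

section
/- Let G be a 2-path with diameter d on n vertices, and let D be any target distribution on G of size t ≥ 1. Then π(G, D) ≤ π_t(G) = t·2^d + n − 2d; that is, every configuration on G of size t·2^d + n − 2d is D-solvable. -/
/-- A single pebbling step: remove two pebbles from `u` and add one to an adjacent `v`. -/
def PebblingStep {V : Type} [DecidableEq V] (G : SimpleGraph V) (C C' : V → ℕ) : Prop :=
  ∃ u v : V, G.Adj u v ∧ 2 ≤ C u ∧
    C' = fun w => if w = u then C u - 2 else if w = v then C v + 1 else C w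

/-- `C` solves the target distribution `D`: some sequence of pebbling steps reaches a
configuration with at least `D v` pebbles on each vertex `v`. -/
def Solvable {V : Type} [DecidableEq V] (G : SimpleGraph V) (C D : V → ℕ) : Prop :=
  ∃ C' : V → ℕ, Relation.ReflTransGen (PebblingStep G) C C' ∧ ∀ v, D v ≤ C' v

/-- The distribution with `t` pebbles stacked on `r` and none elsewhere. -/
def stack {V : Type} [DecidableEq V] (r : V) (t : ℕ) : V → ℕ :=
  fun v => if v = r then t else 0

/-- The pebbling number of the demand `D` in `G`: the smallest `m` such that every
configuration of size `m` is `D`-solvable. -/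
noncomputable def pebblingNumber {V : Type} [Fintype V] [DecidableEq V] (G : SimpleGraph V) (D : V → ℕ) : ℕ :=
  sInf {m | ∀ C : V → ℕ, (∑ v, C v) = m → Solvable G C D}

/-- The `t`-fold pebbling number of `G`. -/
noncomputable def tPebblingNumber {V : Type} [Fintype V] [DecidableEq V]
    (G : SimpleGraph V) (t : ℕ) : ℕ :=
  Finset.univ.sup fun r => pebblingNumber G (stack r t)

/-- Reaching `C'` from `C` by exactly `k` pebbling steps. -/
inductive StepsN {V : Type} [DecidableEq V] (G : SimpleGraph V) : ℕ → (V → ℕ) → (V → ℕ) → Prop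
  | refl (C : V → ℕ) : StepsN G 0 C C
  | tail {k : ℕ} {C C' C'' : V → ℕ} :
      StepsN G k C C' → PebblingStep G C' C'' → StepsN G (k + 1) C C''

/-- `C` has an `r`-solution of cost at most `c` (cost = number of pebbling steps plus one). -/
def CheaplySolvable {V : Type} [DecidableEq V] (G : SimpleGraph V) (C : V → ℕ) (r : V) (c : ℕ) : Prop :=
  ∃ (k : ℕ) (C' : V → ℕ), StepsN G k C C' ∧ 1 ≤ C' r ∧ k + 1 ≤ c

/-- The eccentricity of a vertex: the maximum distance to any other vertex. -/
noncomputable def eccentricity {V : Type} [Fintype V] (G : SimpleGraph V) (r : V) : ℕ :=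
  Finset.univ.sup fun v => G.dist r v

/-- A vertex is simplicial if its neighborhood induces a complete graph. -/
def IsSimplicial {V : Type} (G : SimpleGraph V) (v : V) : Prop :=
  ∀ a b : V, G.Adj v a → G.Adj v b → a ≠ b → G.Adj a b

/-- A 2-path is either `K₂` or `K₃`, or a graph with exactly two simplicial vertices
`u` and `v` such that the neighborhood of `v` induces `K₂` and `G - v` is a 2-path. -/
inductive IsTwoPath : {V : Type} → SimpleGraph V → Prop
  | complete2 {V : Type} (G : SimpleGraph V) :
      Nat.card V = 2 → (∀ a b : V, a ≠ b → G.Adj a b) → IsTwoPath G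
  | complete3 {V : Type} (G : SimpleGraph V) :
      Nat.card V = 3 → (∀ a b : V, a ≠ b → G.Adj a b) → IsTwoPath G
  | extend {V : Type} (G : SimpleGraph V) (u v : V) :
      u ≠ v →
      {w : V | IsSimplicial G w} = {u, v} →
      (G.neighborSet v).ncard = 2 →
      IsSimplicial G v →
      IsTwoPath (G.induce {w : V | w ≠ v}) →
      IsTwoPath G

/-- The Kneser graph `K(m, h)`: vertices are the `h`-element subsets of `{1, …, m}`,
adjacent iff disjoint. -/
def kneserGraph (m h : ℕ) : SimpleGraph {s : Finset (Fin m) // s.card = h} :=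
  SimpleGraph.fromRel fun a b => Disjoint a.1 b.1

namespace Pebbling

variable {V : Type} {G : SimpleGraph V}

/-- `IndPath G l`: consecutive entries of `l` are adjacent and an entry is not adjacent to the
entries from two places later on. -/
def IndPath (G : SimpleGraph V) : List V → Prop
  | [] => True
  | [_] => True
  | a :: b :: l => G.Adj a b ∧ (∀ y ∈ l, ¬ G.Adj a y) ∧ IndPath G (b :: l)

theorem IndPath.tail {a : V} {l : List V} (h : IndPath G (a :: l)) : IndPath G l := by
  cases l with
  | nil => trivial
  | cons b l => exact h.2.2

theorem sum_add_apply [Fintype V] (A B : V → ℕ) :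
    ∑ v, (A + B) v = ∑ v, A v + ∑ v, B v := by
  simp [Finset.sum_add_distrib]

section Solvable

variable [DecidableEq V]

theorem PebblingStep.add_right {C C' : V → ℕ} (h : PebblingStep G C C') (X : V → ℕ) :
    PebblingStep G (C + X) (C' + X) := by
  obtain ⟨u, v, huv, h2, rfl⟩ := h
  refine ⟨u, v, huv, by simp only [Pi.add_apply]; omega, ?_⟩
  funext w
  by_cases hu : w = u
  · subst hu; simp only [Pi.add_apply, if_true]; omega
  · by_cases hv : w = v
    · subst hv; simp only [Pi.add_apply, if_true, if_neg hu]; omega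
    · simp [hu, hv]

theorem reflTransGen_add_right {C C' : V → ℕ}
    (h : Relation.ReflTransGen (PebblingStep G) C C') (X : V → ℕ) :
    Relation.ReflTransGen (PebblingStep G) (C + X) (C' + X) :=
  h.lift (· + X) fun _ _ hs => PebblingStep.add_right hs X

theorem solvable_of_le {A B : V → ℕ} (h : B ≤ A) : Solvable G A B :=
  ⟨A, .refl, h⟩

theorem solvable_trans {A B C : V → ℕ} (h₁ : Solvable G A B) (h₂ : Solvable G B C) :
    Solvable G A C := by
  obtain ⟨A', hA, hAB⟩ := h₁
  obtain ⟨B', hB, hBC⟩ := h₂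
  have hX : A' = B + (A' - B) := by
    funext v; have := hAB v; simp only [Pi.add_apply, Pi.sub_apply]; omega
  refine ⟨B' + (A' - B), hA.trans ?_, fun v => ?_⟩
  · conv_lhs => rw [hX]
    exact reflTransGen_add_right hB _
  · have := hBC v; simp only [Pi.add_apply]; omega

theorem solvable_add {A B A' B' : V → ℕ} (h₁ : Solvable G A B) (h₂ : Solvable G A' B') :
    Solvable G (A + A') (B + B') := by
  obtain ⟨C, hA, hC⟩ := h₁
  obtain ⟨C', hA', hC'⟩ := h₂
  refine ⟨C + C', (reflTransGen_add_right hA A').trans ?_, fun v => add_le_add (hC v) (hC' v)⟩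
  rw [add_comm C A', add_comm C C']
  exact reflTransGen_add_right hA' C

theorem solvable_mono {A A' B B' : V → ℕ} (h : Solvable G A B) (hA : A ≤ A') (hB : B' ≤ B) :
    Solvable G A' B' :=
  solvable_trans (solvable_trans (solvable_of_le hA) h) (solvable_of_le hB)

theorem solvable_single_of_adj {u v : V} (h : G.Adj u v) :
    Solvable G (Pi.single u 2) (Pi.single v 1) := by
  refine ⟨_, .single ⟨u, v, h, by simp, rfl⟩, fun w => ?_⟩
  by_cases hw : w = v
  · subst hw; simp [h.ne']
  · simp [Pi.single_eq_of_ne hw]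

theorem solvable_single_mul_of_adj {u v : V} (h : G.Adj u v) (k : ℕ) :
    Solvable G (Pi.single u (2 * k)) (Pi.single v k) := by
  induction k with
  | zero => exact solvable_of_le (by simp)
  | succ k ih =>
    rw [mul_add, Pi.single_add, Pi.single_add]
    exact solvable_add ih (solvable_single_of_adj h)

/-- Two pebbles slide along a path whose intermediate vertices are occupied. -/
theorem solvable_slide {x w : V} {l₁ l₂ : List V} (h : IndPath G (x :: (l₁ ++ w :: l₂))) :
    Solvable G (Pi.single w 2 + fun v => l₁.count v) (Pi.single x 1) := by
  induction l₁ generalizing x with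
  | nil =>
    refine solvable_mono (solvable_single_of_adj (u := w) (v := x) ?_) (by intro v; simp) le_rfl
    exact h.1.symm
  | cons y l ih =>
    have h1 := ih h.2.2
    have h2 := solvable_add h1 (solvable_of_le (G := G) (le_refl (Pi.single y 1)))
    rw [← Pi.single_add] at h2
    refine solvable_mono (solvable_trans h2 (solvable_single_of_adj h.1.symm)) ?_ le_rfl
    intro v
    by_cases hv : v = y
    · subst hv; simp [add_assoc]
    · have hv' : y ≠ v := fun h => hv h.symm
      simp [hv, hv']

variable [Fintype V]

theorem sum_single (u : V) (k : ℕ) : ∑ v, (Pi.single u k : V → ℕ) v = k := by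
  simp

/-- Halving every pile onto a common neighbor. -/
theorem solvable_push {D E : V → ℕ} {c : V} (hE : ∀ v, E v ≠ 0 → G.Adj v c)
    (hD : ∀ v, 2 * E v ≤ D v) : Solvable G D (Pi.single c (∑ v, E v)) := by
  have key : ∀ s : Finset V, Solvable G (∑ v ∈ s, Pi.single v (2 * E v))
      (Pi.single c (∑ v ∈ s, E v)) := by
    intro s
    induction s using Finset.induction_on with
    | empty => exact solvable_of_le (by simp)
    | insert a s ha ih =>
      rw [Finset.sum_insert ha, Finset.sum_insert ha, Pi.single_add]
      refine solvable_add ?_ ih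
      by_cases h0 : E a = 0
      · exact solvable_of_le (by simp [h0])
      · exact solvable_single_mul_of_adj (hE a h0) _
  refine solvable_mono (key Finset.univ) ?_ le_rfl
  rw [Finset.univ_sum_single]
  exact hD

theorem solvable_slide_push {c x w : V} {l : List V} {D E : V → ℕ}
    (h : IndPath G (x :: l)) (hl : l.Nodup) (hc : ∀ v ∈ l, G.Adj v c) (hw : w ∈ l)
    (hE : ∀ v, E v ≠ 0 → v ∈ l) (hDw : 2 * E w + 2 ≤ D w)
    (hD : ∀ v ∈ l, v ≠ w → 2 * E v + 1 ≤ D v) :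
    Solvable G D (Pi.single c (∑ v, E v) + Pi.single x 1) := by
  obtain ⟨l₁, l₂, rfl⟩ := List.append_of_mem hw
  have h1 := solvable_push (D := fun v => 2 * E v) (fun v hv => hc v (hE v hv)) (fun _ => le_rfl)
  refine solvable_mono (solvable_add h1 (solvable_slide h)) ?_ le_rfl
  intro v
  by_cases hv : v = w
  · subst hv
    have : v ∉ l₁ := fun hv => (List.nodup_append.mp hl).2.2 v hv v (by simp) rfl
    simp only [Pi.add_apply, Pi.single_eq_same, List.count_eq_zero_of_not_mem this]
    omega
  · have h3 := List.nodup_iff_count_le_one.mp (List.nodup_append.mp hl).1 v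
    simp only [Pi.add_apply, Pi.single_eq_of_ne hv]
    by_cases hvl : v ∈ l₁
    · have := hD v (by simp [hvl]) hv
      omega
    · rw [List.count_eq_zero_of_not_mem hvl]
      by_cases h0 : E v = 0
      · simp [h0]
      · have := hD v (hE v h0) hv
        omega

end Solvable

/-- `Side G j c x S`: the vertices of `S` form `j + 1` layers hanging off the edge `c x`.
Each layer is an induced path, the vertices of the first layer are all adjacent to `c`, and its
first vertex is adjacent to `x`. The deeper layers hang off the last two vertices of the
first layer. -/
inductive Side (G : SimpleGraph V) : ℕ → V → V → List V → Prop
  | base {c x : V} {l : List V} (hne : l ≠ []) (hl : l.Nodup) (hp : IndPath G (x :: l))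
      (hc : ∀ v ∈ l, G.Adj v c) : Side G 0 c x l
  | step {j : ℕ} {c x c' x' : V} {l₀ l S : List V} (hS : Side G j c' x' S)
      (hlast : l = l₀ ++ [c', x'] ∨ l = l₀ ++ [x', c']) (hl : (l ++ S).Nodup)
      (hp : IndPath G (x :: l)) (hc : ∀ v ∈ l, G.Adj v c)
      (hcl : ∀ s ∈ S, ∀ y, G.Adj s y → y ∈ S ∨ y = c' ∨ y = x') : Side G (j + 1) c x (l ++ S)

/-- The part of the configuration `C` on the list `S`. -/
def cut [DecidableEq V] (S : List V) (C : V → ℕ) : V → ℕ := fun v => if v ∈ S then C v else 0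

theorem cut_le [DecidableEq V] (S : List V) (C : V → ℕ) : cut S C ≤ C := by
  intro v; unfold cut; split_ifs <;> simp

theorem cut_of_mem [DecidableEq V] {S : List V} {v : V} (h : v ∈ S) (C : V → ℕ) :
    cut S C v = C v := if_pos h

theorem cut_of_not_mem [DecidableEq V] {S : List V} {v : V} (h : v ∉ S) (C : V → ℕ) :
    cut S C v = 0 := if_neg h

theorem cut_append [DecidableEq V] {S T : List V} (h : (S ++ T).Nodup) (C : V → ℕ) :
    cut (S ++ T) C = cut S C + cut T C := by
  funext v
  have : v ∈ S → v ∉ T := fun h1 h2 => (List.nodup_append.mp h).2.2 v h1 v h2 rfl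
  simp only [cut, List.mem_append, Pi.add_apply]
  by_cases h1 : v ∈ S <;> by_cases h2 : v ∈ T <;> simp_all

theorem cut_cons [DecidableEq V] {a : V} {S : List V} (h : (a :: S).Nodup) (C : V → ℕ) :
    cut (a :: S) C = Pi.single a (C a) + cut S C := by
  have h1 := cut_append (S := [a]) (T := S) h C
  rw [List.singleton_append] at h1
  rw [h1]
  congr 1
  funext v
  by_cases hv : v = a
  · subst hv; simp [cut]
  · simp [cut, hv]

theorem sum_cut_le [Fintype V] [DecidableEq V] {S : List V} (hS : S.Nodup) {C : V → ℕ} {k : ℕ}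
    (h : ∀ v ∈ S, C v ≤ k) : ∑ v, cut S C v ≤ k * S.length := by
  induction S with
  | nil => simp [cut]
  | cons a S ih =>
    rw [cut_cons hS, sum_add_apply, sum_single, List.length_cons]
    have h1 := ih hS.of_cons fun v hv => h v (by simp [hv])
    have h2 := h a (by simp)
    nlinarith

theorem cut_eq_self [DecidableEq V] {S : List V} {C : V → ℕ} (h : ∀ v ∉ S, C v = 0) :
    cut S C = C := by
  funext v
  by_cases hv : v ∈ S
  · exact cut_of_mem hv C
  · rw [cut_of_not_mem hv, h v hv]

theorem sum_cut_one [Fintype V] [DecidableEq V] {l : List V} (hl : l.Nodup) :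
    ∑ v, cut l (fun _ => 1) v = l.length := by
  induction l with
  | nil => simp [cut]
  | cons a l ih =>
    rw [cut_cons hl, sum_add_apply, sum_single, ih hl.of_cons, List.length_cons, add_comm]

/-- The number of odd piles is at most the number of vertices; the cases of at most one
even pile are characterized. -/
theorem sum_mod_two [Fintype V] [DecidableEq V] {l : List V} (hl : l.Nodup) {B : V → ℕ}
    (hB : ∀ v ∉ l, B v = 0) :
    ∑ v, B v % 2 ≤ l.length ∧ ((∑ v, B v % 2) = l.length → ∀ v ∈ l, B v % 2 = 1) ∧
    ((∑ v, B v % 2) + 1 = l.length → ∃ z ∈ l, ∀ v ∈ l, v ≠ z → B v % 2 = 1) := by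
  have hind := sum_cut_one (V := V) hl
  have hle : ∀ v, B v % 2 ≤ cut l (fun _ => 1) v := by
    intro v
    by_cases hv : v ∈ l
    · rw [cut_of_mem hv]; omega
    · rw [cut_of_not_mem hv, hB v hv]
  have one : ∀ z ∈ l, B z % 2 ≠ 1 → (∑ v, B v % 2) + 1 ≤ l.length := by
    intro z hz hz1
    have : ∑ v, (B v % 2 + (Pi.single z 1 : V → ℕ) v) ≤ ∑ v, cut l (fun _ => 1) v := by
      refine Finset.sum_le_sum fun v _ => ?_
      by_cases hv : v = z
      · subst hv; rw [cut_of_mem hz, Pi.single_eq_same]; omega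
      · rw [Pi.single_eq_of_ne hv]; exact hle v
    rwa [Finset.sum_add_distrib, sum_single, hind] at this
  refine ⟨hind ▸ Finset.sum_le_sum fun v _ => hle v, fun h v hv => ?_, fun h => ?_⟩
  · by_contra hc
    have := one v hv hc
    omega
  · by_cases hall : ∀ z ∈ l, B z % 2 = 1
    · have : l ≠ [] := by rintro rfl; simp at h
      obtain ⟨z, hz⟩ := List.exists_mem_of_ne_nil l this
      exact ⟨z, hz, fun v hv _ => hall v hv⟩
    push Not at hall
    obtain ⟨z, hz, hz1⟩ := hall
    refine ⟨z, hz, fun y hy hyz => ?_⟩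
    by_contra hc
    have : ∑ v, (B v % 2 + (Pi.single z 1 : V → ℕ) v + (Pi.single y 1 : V → ℕ) v) ≤
        ∑ v, cut l (fun _ => 1) v := by
      refine Finset.sum_le_sum fun v _ => ?_
      by_cases hv : v = z
      · subst hv
        rw [cut_of_mem hz, Pi.single_eq_same, Pi.single_eq_of_ne (Ne.symm hyz)]; omega
      · rw [Pi.single_eq_of_ne hv]
        by_cases hv' : v = y
        · subst hv'; rw [cut_of_mem hy, Pi.single_eq_same]; omega
        · rw [Pi.single_eq_of_ne hv']; exact hle v
    rw [Finset.sum_add_distrib, Finset.sum_add_distrib, sum_single, sum_single, hind] at this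
    omega

theorem sum_eq_two_mul_add [Fintype V] (B : V → ℕ) :
    ∑ v, B v = 2 * ∑ v, B v / 2 + ∑ v, B v % 2 := by
  rw [Finset.mul_sum, ← Finset.sum_add_distrib]
  exact Finset.sum_congr rfl fun v _ => (Nat.div_add_mod _ _).symm

/-- If all piles on the layer are odd, two pebbles can be spared to slide to `x`. -/
theorem solvable_of_odd [Fintype V] [DecidableEq V] {c x : V} {l : List V} {D : V → ℕ} {s : ℕ}
    (h : IndPath G (x :: l)) (hl : l.Nodup) (hc : ∀ v ∈ l, G.Adj v c)
    (hD0 : ∀ v ∉ l, D v = 0) (hodd : ∀ v ∈ l, D v % 2 = 1) (hs : ∑ v, D v / 2 = s + 1) :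
    Solvable G D (Pi.single c s + Pi.single x 1) := by
  obtain ⟨w, -, hw⟩ : ∃ w ∈ Finset.univ, D w / 2 ≠ 0 := by
    apply Finset.exists_ne_zero_of_sum_ne_zero; omega
  have hwl : w ∈ l := by
    by_contra hwl; exact hw (by rw [hD0 w hwl])
  let E : V → ℕ := fun v => if v = w then D v / 2 - 1 else D v / 2
  have hE : ∑ v, E v = s := by
    have : ∑ v, D v / 2 = ∑ v, E v + 1 := by
      rw [← sum_single w 1, ← Finset.sum_add_distrib]
      refine Finset.sum_congr rfl fun v _ => ?_
      by_cases hv : v = w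
      · subst hv; simp only [E, if_true, Pi.single_eq_same]; omega
      · simp [E, hv]
    omega
  rw [← hE]
  refine solvable_slide_push h hl hc hwl (fun v hv => ?_) ?_ fun v hv hvw => ?_
  · by_contra hvl
    apply hv; simp [E, hD0 v hvl]
  · simp only [E, if_true]; omega
  · have := hodd v hv
    simp only [E, if_neg hvw]; omega

theorem exists_solvable_of_side [Fintype V] [DecidableEq V] {j : ℕ} {c x : V} {S : List V}
    (h : Side G j c x S) (C : V → ℕ) (hC : ∀ v ∉ S, C v = 0) :
    ∃ s, Solvable G C (Pi.single c s) ∧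
      ∑ v, C v + 2 * (j + 1) ≤ S.length + 2 ^ (j + 1) * (s + 1) ∧
      (∑ v, C v + 2 * (j + 1) = S.length + 2 ^ (j + 1) * (s + 1) → ∀ s₀, s = s₀ + 1 →
        Solvable G C (Pi.single c s₀ + Pi.single x 1)) := by
  induction h generalizing C with
  | @base c x l hne hl hp hc =>
    obtain ⟨h1, h2, -⟩ := sum_mod_two hl hC
    have h3 := sum_eq_two_mul_add C
    refine ⟨∑ v, C v / 2, solvable_push (fun v hv => hc v ?_) fun v => ?_, ?_, ?_⟩
    · by_contra hvl; exact hv (by rw [hC v hvl])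
    · omega
    · omega
    · intro heq s₀ hs
      exact solvable_of_odd hp hl hc hC (h2 (by omega)) hs
  | @step j c x c' x' l₀ l S hS hlast hl hp hc hcl ih =>
    have hc' : c' ∈ l := by rcases hlast with rfl | rfl <;> simp
    have hx' : x' ∈ l := by rcases hlast with rfl | rfl <;> simp
    have hln : l.Nodup := (List.nodup_append.mp hl).1
    have hcx : c' ≠ x' := by
      rcases hlast with rfl | rfl
      · have := (List.nodup_append.mp hln).2.1; simp at this; exact this
      · have := (List.nodup_append.mp hln).2.1; simp at this; exact fun h => this h.symm
    have hsplit : C = cut S C + cut l C := by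
      rw [add_comm, ← cut_append hl, cut_eq_self hC]
    obtain ⟨s', hs', hT, hflag⟩ := ih (cut S C) fun v hv => cut_of_not_mem hv C
    set A := cut S C with hA
    set B := cut l C with hB
    have hBl : ∀ v ∉ l, B v = 0 := fun v hv => cut_of_not_mem hv C
    have hN : ∑ v, C v = ∑ v, A v + ∑ v, B v := by
      conv_lhs => rw [hsplit]
      exact sum_add_apply A B
    -- the two ways of receiving pebbles from the deeper layers
    have to1 : ∀ Y, Solvable G (Pi.single c' s' + B) Y → Solvable G C Y := by
      intro Y hY
      rw [hsplit]
      exact solvable_trans (solvable_add hs' (solvable_of_le le_rfl)) hY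
    have to2 : ∀ t, Solvable G A (Pi.single c' t + Pi.single x' 1) → ∀ Y,
        Solvable G (Pi.single c' t + Pi.single x' 1 + B) Y → Solvable G C Y := by
      intro t ht Y hY
      rw [hsplit]
      exact solvable_trans (solvable_add ht (solvable_of_le le_rfl)) hY
    have hB1l : ∀ v ∉ l, (Pi.single c' s' + B : V → ℕ) v = 0 := by
      intro v hv
      have : v ≠ c' := fun h => hv (h ▸ hc')
      simp [this, hBl v hv]
    have hB1c : (Pi.single c' s' + B : V → ℕ) c' = s' + B c' := by simp
    have hB1n : ∀ v, v ≠ c' → (Pi.single c' s' + B : V → ℕ) v = B v := by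
      intro v hv; simp [hv]
    have hsum := sum_add_apply (Pi.single c' s') B
    rw [sum_single] at hsum
    set B1 : V → ℕ := Pi.single c' s' + B with hB1
    obtain ⟨h1, h2, h3⟩ := sum_mod_two hln hB1l
    have h4 := sum_eq_two_mul_add B1
    set s := ∑ v, B1 v / 2 with hsdef
    have hdel : Solvable G C (Pi.single c s) := by
      refine to1 _ (solvable_push (fun v hv => hc v ?_) fun v => ?_)
      · by_contra hvl; exact hv (by rw [hB1l v hvl])
      · omega
    have hs's : s' ≤ 2 * s + 1 := by
      have : B1 c' / 2 ≤ s := Finset.single_le_sum (f := fun v => B1 v / 2)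
        (fun _ _ => Nat.zero_le _) (Finset.mem_univ c')
      omega
    set ℓ := ∑ v, B1 v % 2 with hℓ
    -- one more pair appears if `x'` receives a pebble and `c'`, `x'` carry odd piles
    have gain : ∀ t, s' = t + 1 → Solvable G A (Pi.single c' t + Pi.single x' 1) →
        B1 c' % 2 = 1 → B1 x' % 2 = 1 → Solvable G C (Pi.single c (s + 1)) := by
      intro t ht hA2 hco hxo
      refine to2 t hA2 _ ?_
      have : s + 1 = ∑ v, (B1 v / 2 + (Pi.single x' 1 : V → ℕ) v) := by
        rw [Finset.sum_add_distrib, sum_single]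
      rw [this]
      refine solvable_push (fun v hv => hc v ?_) fun v => ?_
      · by_contra hvl
        have : v ≠ x' := fun h => hvl (h ▸ hx')
        exact hv (by simp [hB1l v hvl, this])
      · by_cases hv1 : v = c'
        · subst hv1
          simp only [Pi.add_apply, Pi.single_eq_same, Pi.single_eq_of_ne hcx]
          omega
        · by_cases hv2 : v = x'
          · subst hv2
            have := hB1n v hv1
            simp only [Pi.add_apply, Pi.single_eq_same, Pi.single_eq_of_ne hv1]
            omega
          · have := hB1n v hv1
            simp only [Pi.add_apply, Pi.single_eq_of_ne hv1, Pi.single_eq_of_ne hv2]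
            omega
    have hK : 2 ≤ 2 ^ (j + 1) := by
      rw [pow_succ]; have := Nat.one_le_two_pow (n := j); omega
    have hpow : 2 ^ (j + 1 + 1) = 2 * 2 ^ (j + 1) := by ring
    rw [List.length_append, hpow]
    set K := 2 ^ (j + 1) with hKdef
    have gain' : Solvable G C (Pi.single c (s + 1)) → ∃ s, Solvable G C (Pi.single c s) ∧
      ∑ v, C v + 2 * (j + 1 + 1) ≤ l.length + S.length + 2 * K * (s + 1) ∧
      (∑ v, C v + 2 * (j + 1 + 1) = l.length + S.length + 2 * K * (s + 1) → ∀ s₀, s = s₀ + 1 →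
        Solvable G C (Pi.single c s₀ + Pi.single x 1)) := by
      intro hg
      have : ∑ v, C v + 2 * (j + 1 + 1) < l.length + S.length + 2 * K * (s + 1 + 1) := by
        nlinarith
      exact ⟨s + 1, hg, this.le, fun h => absurd h this.ne⟩
    obtain ⟨a, ha⟩ := Nat.exists_eq_add_of_le hT
    obtain ⟨δ, hδ⟩ := Nat.exists_eq_add_of_le h1
    rcases Nat.lt_or_ge (2 * s) s' with hlt | hge
    · have hs'eq : s' = 2 * s + 1 := by omega
      have hKs : K * (s' + 1) = 2 * K * (s + 1) := by rw [hs'eq]; ring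
      rw [hKs] at ha hflag
      by_cases ha0 : a = 0
      · have hA2 := hflag (by omega) (2 * s) hs'eq
        by_cases hδ0 : δ = 0
        · have hodd := h2 (by omega)
          exact gain' (gain _ hs'eq hA2 (hodd _ hc') (hodd _ hx'))
        by_cases hδ1 : δ = 1
        · obtain ⟨z, hz, hzodd⟩ := h3 (by omega)
          have hzc : z ≠ c' := by
            rintro rfl
            have : ∑ v, cut l (fun _ => 1) v ≤ ∑ v, (B v + (Pi.single z 1 : V → ℕ) v) := by
              refine Finset.sum_le_sum fun v _ => ?_
              by_cases hv : v ∈ l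
              · rw [cut_of_mem hv]
                by_cases hvz : v = z
                · subst hvz; simp
                · have := hzodd v hv hvz
                  rw [hB1n v hvz] at this; omega
              · rw [cut_of_not_mem hv]; exact Nat.zero_le _
            rw [Finset.sum_add_distrib, sum_single, sum_cut_one hln] at this
            omega
          have hco := hzodd c' hc' hzc.symm
          by_cases hzx : z = x'
          · subst hzx
            refine ⟨s, hdel, by omega, fun _ s₀ hs₀ => to2 _ hA2 _ ?_⟩
            have hE : s₀ = ∑ v, (Pi.single c' s₀ : V → ℕ) v := (sum_single _ _).symm
            rw [hE]
            refine solvable_slide_push hp hln hc hc' (fun v hv => ?_) ?_ fun v hv hvc => ?_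
            · by_contra hvl
              have : v ≠ c' := fun h => hvl (h ▸ hc')
              exact hv (by rw [Pi.single_eq_of_ne this])
            · simp only [Pi.add_apply, Pi.single_eq_same, Pi.single_eq_of_ne hcx]
              omega
            · by_cases hvz : v = z
              · subst hvz
                simp only [Pi.add_apply, Pi.single_eq_same, Pi.single_eq_of_ne hvc]
                omega
              · have := hzodd v hv hvz
                rw [hB1n v hvc] at this
                simp only [Pi.add_apply, Pi.single_eq_of_ne hvc, Pi.single_eq_of_ne hvz]
                omega
          · exact gain' (gain _ hs'eq hA2 hco (hzodd x' hx' (Ne.symm hzx)))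
        · exact ⟨s, hdel, by omega, fun h => by omega⟩
      · refine ⟨s, hdel, by omega, fun heq s₀ hs₀ => to1 _ ?_⟩
        exact solvable_of_odd hp hln hc hB1l (h2 (by omega)) hs₀
    · obtain ⟨b, hb⟩ := Nat.exists_eq_add_of_le hge
      have hKs : K * (s' + 1) + K + b * (K - 1) + b = 2 * K * (s + 1) := by
        obtain ⟨k, hk⟩ : ∃ k, K = k + 1 := ⟨K - 1, by omega⟩
        rw [hk]
        have : 2 * (k + 1) * (s + 1) = (k + 1) * (2 * s) + 2 * (k + 1) := by ring
        rw [this, hb, Nat.add_sub_cancel]; ring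
      have hpos : b ≤ b * (K - 1) := Nat.le_mul_of_pos_right _ (by omega)
      by_cases htight : K = 2 ∧ b = 0 ∧ a = 0 ∧ δ = 0 ∧ s ≠ 0
      · obtain ⟨-, hb0, ha0, hδ0, hs0⟩ := htight
        have hodd := h2 (by omega)
        obtain ⟨t, ht⟩ := Nat.exists_eq_succ_of_ne_zero (n := s') (by omega)
        exact gain' (gain _ ht (hflag (by omega) t ht) (hodd _ hc') (hodd _ hx'))
      · exact ⟨s, hdel, by omega, fun heq s₀ hs₀ => absurd (by omega) htight⟩

theorem sum_sub_add [Fintype V] {A B : V → ℕ} (h : A ≤ B) :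
    ∑ v, (B - A) v + ∑ v, A v = ∑ v, B v := by
  rw [← Finset.sum_add_distrib]
  exact Finset.sum_congr rfl fun v _ => Nat.sub_add_cancel (h v)

theorem exists_cheap_two [Fintype V] [DecidableEq V] {c : V} {S : List V} {p q K : ℕ}
    (h : ∀ C : V → ℕ, (∀ v ∉ S, C v = 0) → p < ∑ v, C v + q →
      ∃ C₀ ≤ C, ∑ v, C₀ v ≤ K ∧ Solvable G C₀ (Pi.single c 1))
    (C : V → ℕ) (hC : ∀ v ∉ S, C v = 0) (hp : p + K < ∑ v, C v + q) :
    ∃ C₀ ≤ C, ∑ v, C₀ v ≤ 2 * K ∧ Solvable G C₀ (Pi.single c 2) := by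
  obtain ⟨C₁, h1, h1K, h1s⟩ := h C hC (by omega)
  have hsum := sum_sub_add h1
  obtain ⟨C₂, h2, h2K, h2s⟩ := h (C - C₁) (fun v hv => by simp [hC v hv]) (by omega)
  refine ⟨C₁ + C₂, fun v => ?_, ?_, ?_⟩
  · have := h1 v; have := h2 v
    simp only [Pi.add_apply, Pi.sub_apply] at *; omega
  · rw [sum_add_apply]; omega
  · have := solvable_add h1s h2s
    rwa [← Pi.single_add] at this

/-- A side with enough pebbles has a cheap solution at `c`. -/
theorem Side.exists_cheap [Fintype V] [DecidableEq V] {j : ℕ} {c x : V} {S : List V}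
    (h : Side G j c x S) (C : V → ℕ) (hC : ∀ v ∉ S, C v = 0)
    (hsum : S.length + 2 ^ (j + 1) < ∑ v, C v + (j + 2)) :
    ∃ C₀ ≤ C, ∑ v, C₀ v ≤ 2 ^ (j + 1) ∧ Solvable G C₀ (Pi.single c 1) := by
  have two : ∀ (v : V) (j : ℕ), 2 ≤ C v → G.Adj v c →
      ∃ C₀ ≤ C, ∑ v, C₀ v ≤ 2 ^ (j + 1) ∧ Solvable G C₀ (Pi.single c 1) := by
    intro v j hv hvc
    refine ⟨Pi.single v 2, fun y => ?_, ?_, solvable_single_of_adj hvc⟩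
    · by_cases hy : y = v
      · subst hy; simpa using hv
      · simp [hy]
    · rw [sum_single, pow_succ]
      have := Nat.one_le_two_pow (n := j); omega
  induction h generalizing C with
  | @base c x l hne hl hp hc =>
    by_cases hv : ∃ v ∈ l, 2 ≤ C v
    · obtain ⟨v, hvl, hv⟩ := hv
      exact two v 0 hv (hc v hvl)
    · push Not at hv
      have := sum_cut_le hl (C := C) (k := 1) fun v hvl => by have := hv v hvl; omega
      rw [cut_eq_self hC] at this
      omega
  | @step j c x c' x' l₀ l S hS hlast hl hp hc hcl ih =>
    by_cases hv : ∃ v ∈ l, 2 ≤ C v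
    · obtain ⟨v, hvl, hv⟩ := hv
      exact two v (j + 1) hv (hc v hvl)
    push Not at hv
    have hln : l.Nodup := (List.nodup_append.mp hl).1
    have hc' : c' ∈ l := by rcases hlast with rfl | rfl <;> simp
    have hNl := sum_cut_le hln (C := C) (k := 1) fun v hvl => by have := hv v hvl; omega
    have hsplit : C = cut S C + cut l C := by
      rw [add_comm, ← cut_append hl, cut_eq_self hC]
    have hN : ∑ v, C v = ∑ v, cut S C v + ∑ v, cut l C v := by
      conv_lhs => rw [hsplit]
      exact sum_add_apply _ _
    have hQ : ∀ C : V → ℕ, (∀ v ∉ S, C v = 0) → S.length + 2 ^ (j + 1) < ∑ v, C v + (j + 2) →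
        ∃ C₀ ≤ C, ∑ v, C₀ v ≤ 2 ^ (j + 1) ∧ Solvable G C₀ (Pi.single c' 1) := by
      intro D hD hs
      refine ih D hD hs fun v j hv hvc => ?_
      refine ⟨Pi.single v 2, fun y => ?_, ?_, solvable_single_of_adj hvc⟩
      · by_cases hy : y = v
        · subst hy; simpa using hv
        · simp [hy]
      · rw [sum_single, pow_succ]
        have := Nat.one_le_two_pow (n := j); omega
    have hoff : ∀ v ∉ S, cut S C v = 0 := fun v hv => cut_of_not_mem hv C
    have hpow : 2 ^ (j + 1 + 1) = 2 * 2 ^ (j + 1) := by ring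
    have hK : 2 ≤ 2 ^ (j + 1) := by
      rw [pow_succ]; have := Nat.one_le_two_pow (n := j); omega
    rw [hpow] at hsum ⊢
    rw [List.length_append] at hsum
    by_cases hbig : S.length + 2 ^ (j + 1) + 2 ^ (j + 1) < ∑ v, cut S C v + (j + 2)
    · obtain ⟨C₀, h1, h2, h3⟩ := exists_cheap_two hQ _ hoff hbig
      exact ⟨C₀, h1.trans (cut_le S C), h2, solvable_trans h3 (solvable_single_of_adj (hc _ hc'))⟩
    · obtain ⟨C₀, h1, h2, h3⟩ := hQ _ hoff (by omega)
      have hc1 : 1 ≤ C c' := by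
        by_contra h0
        have hle : ∑ v, (cut l C v + (Pi.single c' 1 : V → ℕ) v) ≤
            ∑ v, cut l (fun _ => 1) v := by
          refine Finset.sum_le_sum fun v _ => ?_
          by_cases hvl : v ∈ l
          · rw [cut_of_mem hvl, cut_of_mem hvl]
            by_cases hvc : v = c'
            · subst hvc; rw [Pi.single_eq_same]; omega
            · rw [Pi.single_eq_of_ne hvc]; have := hv v hvl; omega
          · have hvc : v ≠ c' := fun h => hvl (h ▸ hc')
            rw [cut_of_not_mem hvl, Pi.single_eq_of_ne hvc]; exact Nat.zero_le _
        rw [Finset.sum_add_distrib, sum_single, sum_cut_one hln] at hle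
        omega
      refine ⟨C₀ + Pi.single c' 1, fun v => ?_, ?_, ?_⟩
      · have : C₀ v ≤ cut S C v := h1 v
        by_cases hvc : v = c'
        · subst hvc
          have hvS : v ∉ S := fun hv => (List.nodup_append.mp hl).2.2 v hc' v hv rfl
          rw [cut_of_not_mem hvS] at this
          rw [Pi.add_apply, Pi.single_eq_same, Nat.le_zero.mp this, zero_add]; exact hc1
        · rw [Pi.add_apply, Pi.single_eq_of_ne hvc]; exact this.trans (cut_le S C v)
      · rw [sum_add_apply, sum_single]; omega
      · have := solvable_add h3 (solvable_of_le (G := G) (le_refl (Pi.single c' 1)))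
        rw [← Pi.single_add] at this
        exact solvable_trans this (solvable_single_of_adj (hc _ hc'))

/-- Moving the edge `a b` of a side to `a w`, where `w` is a common neighbor outside. -/
theorem Side.shift {j : ℕ} {c x : V} {S : List V} (h : Side G j c x S) {a b w : V}
    (hcx : c = a ∧ x = b ∨ c = b ∧ x = a) (hab : G.Adj a b) (hwa : G.Adj w a)
    (hwb : G.Adj w b) (haS : a ∉ S) (hbS : b ∉ S) (hwS : w ∉ S)
    (hcl : ∀ s ∈ S, ∀ y, G.Adj s y → y ∈ S ∨ y = a ∨ y = b) :
    ∃ j', Side G j' a w (b :: S) := by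
  induction h generalizing a b w with
  | @base c x l hne hl hp hc =>
    have hw : ∀ y ∈ l, ¬ G.Adj w y := by
      intro y hy h
      rcases hcl y hy w h.symm with h | rfl | rfl
      · exact hwS h
      · exact hwa.ne rfl
      · exact hwb.ne rfl
    rcases hcx with ⟨rfl, rfl⟩ | ⟨rfl, rfl⟩
    · refine ⟨0, .base (by simp) (List.nodup_cons.mpr ⟨hbS, hl⟩) ⟨hwb, hw, hp⟩ ?_⟩
      simpa using ⟨hab.symm, hc⟩
    · obtain ⟨h, l', rfl⟩ := List.exists_cons_of_ne_nil hne
      have hp1 : IndPath G (w :: [c, h]) :=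
        ⟨hwb, by simpa using hw h (by simp), (hc h (by simp)).symm, by simp, trivial⟩
      have hc1 : ∀ v ∈ [c, h], G.Adj v x := by simpa using ⟨hab.symm, hp.1.symm⟩
      have hn : ([c, h] ++ l').Nodup := List.nodup_cons.mpr ⟨hbS, hl⟩
      by_cases hl' : l' = []
      · subst hl'
        exact ⟨0, .base (by simp) hn hp1 hc1⟩
      · refine ⟨1, Side.step (l₀ := []) (l := [c, h]) (c' := c) (x' := h)
          (Side.base hl' hl.of_cons hp.tail fun v hv => hc v (by simp [hv])) (.inl rfl) hn hp1 hc1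
          fun s hs y hy => ?_⟩
        rcases hcl s (by simp [hs]) y hy with h1 | rfl | rfl
        · rcases List.mem_cons.mp h1 with rfl | h1 <;> simp [*]
        · exact absurd hy.symm (hp.2.1 s hs)
        · simp
  | @step j c x c' x' l₀ l S hS hlast hl hp hc hcl' ih =>
    have hw : ∀ y ∈ l, ¬ G.Adj w y := by
      intro y hy h
      rcases hcl y (by simp [hy]) w h.symm with h | rfl | rfl
      · exact hwS h
      · exact hwa.ne rfl
      · exact hwb.ne rfl
    rcases hcx with ⟨rfl, rfl⟩ | ⟨rfl, rfl⟩
    · refine ⟨j + 1, Side.step (l₀ := x :: l₀) (l := x :: l) hS ?_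
        (List.nodup_cons.mpr ⟨hbS, hl⟩) ⟨hwb, hw, hp⟩ (by simpa using ⟨hab.symm, hc⟩) hcl'⟩
      rcases hlast with rfl | rfl <;> simp
    · have hc'l : c' ∈ l := by rcases hlast with rfl | rfl <;> simp
      have hx'l : x' ∈ l := by rcases hlast with rfl | rfl <;> simp
      have hxl : x ∉ l := fun h => haS (by simp [h])
      have hSx : ∀ s ∈ S, ¬ G.Adj s x := by
        intro s hs h
        rcases hcl' s hs x h with h | rfl | rfl
        · exact haS (by simp [h])
        · exact hxl hc'l
        · exact hxl hx'l
      obtain ⟨h, l', rfl⟩ := List.exists_cons_of_ne_nil (List.ne_nil_of_mem hc'l)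
      have hp1 : IndPath G (w :: [c, h]) :=
        ⟨hwb, by simpa using hw h (by simp), (hc h (by simp)).symm, by simp, trivial⟩
      have hc1 : ∀ v ∈ [c, h], G.Adj v x := by simpa using ⟨hab.symm, hp.1.symm⟩
      have hn : ([c, h] ++ (l' ++ S)).Nodup := List.nodup_cons.mpr ⟨hbS, hl⟩
      have hclosed : ∀ s ∈ l' ++ S, ∀ y, G.Adj s y → y ∈ l' ++ S ∨ y = h ∨ y = c := by
        intro s hs y hy
        rcases hcl s (by simpa using .inr (List.mem_append.mp hs)) y hy with h1 | rfl | rfl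
        · have : y = h ∨ y ∈ l' ++ S := by simpa using h1
          tauto
        · rcases List.mem_append.mp hs with hs | hs
          · exact absurd hy.symm (hp.2.1 s hs)
          · exact absurd hy (hSx s hs)
        · simp
      cases l₀ with
      | nil =>
        obtain ⟨h2, rfl, hor⟩ : ∃ h2, l' = [h2] ∧ (c' = h ∧ x' = h2 ∨ c' = h2 ∧ x' = h) := by
          rcases hlast with h1 | h1 <;> simp at h1 <;> obtain ⟨rfl, rfl⟩ := h1
          · exact ⟨_, rfl, .inl ⟨rfl, rfl⟩⟩
          · exact ⟨_, rfl, .inr ⟨rfl, rfl⟩⟩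
        have hnd : ((h :: [h2]) ++ S).Nodup := hl
        simp only [List.cons_append, List.nil_append, List.nodup_cons, List.mem_cons, not_or] at hnd
        obtain ⟨j', hj'⟩ := ih (a := h) (b := h2) (w := c) hor hp.2.2.1 (hc h (by simp)).symm
          (hc h2 (by simp)).symm hnd.1.2 hnd.2.1 (fun hm => hbS (by simp [hm])) fun s hs y hy => by
            rcases hor with ⟨rfl, rfl⟩ | ⟨rfl, rfl⟩
            · exact hcl' s hs y hy
            · have := hcl' s hs y hy; tauto
        exact ⟨j' + 1, Side.step (l₀ := []) (l := [c, h]) hj' (.inr rfl) hn hp1 hc1 hclosed⟩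
      | cons h' l₁ =>
        have hlast' : l' = l₁ ++ [c', x'] ∨ l' = l₁ ++ [x', c'] := by
          rcases hlast with h1 | h1 <;> simp at h1
          · exact .inl h1.2
          · exact .inr h1.2
        have hinner : Side G (j + 1) c h (l' ++ S) :=
          Side.step hS hlast' hl.of_cons hp.tail (fun v hv => hc v (by simp [hv])) hcl'
        refine ⟨j + 1 + 1, Side.step (l₀ := []) (l := [c, h]) hinner (.inl rfl) hn hp1 hc1
          fun s hs y hy => ?_⟩
        have := hclosed s hs y hy
        tauto

/-- `Half G u a b S`: the vertices of `S` are the part of a 2-path that is cut off by the edge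
`a b` and contains the end `u`. -/
inductive Half (G : SimpleGraph V) (u : V) : V → V → List V → Prop
  | base {a b : V} (hua : G.Adj u a) (hub : G.Adj u b) (hab : G.Adj a b)
      (hu : ∀ x, G.Adj u x → x = a ∨ x = b) : Half G u a b [u]
  | push {a b w : V} {S : List V} (h : Half G u a b S) (hwa : G.Adj w a) (hwb : G.Adj w b)
      (hw : w ∉ S) (hb : ∀ x, G.Adj b x → x ∈ S ∨ x = a ∨ x = w) : Half G u a w (b :: S)
  | swap {a b : V} {S : List V} (h : Half G u a b S) : Half G u b a S

theorem Half.basic {u a b : V} {S : List V} (h : Half G u a b S) :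
    u ∈ S ∧ G.Adj a b ∧ a ∉ S ∧ b ∉ S ∧ S.Nodup ∧
      ∀ s ∈ S, ∀ y, G.Adj s y → y ∈ S ∨ y = a ∨ y = b := by
  induction h with
  | base hua hub hab hu =>
    refine ⟨by simp, hab, by simpa using hua.ne', by simpa using hub.ne', by simp, ?_⟩
    intro s hs y hy
    rw [List.mem_singleton] at hs
    subst hs
    exact .inr (hu y hy)
  | @push a b w S h hwa hwb hw hb ih =>
    obtain ⟨h1, h2, h3, h4, h5, h6⟩ := ih
    refine ⟨by simp [h1], hwa.symm, by simp [h3, h2.ne], by simp [hw, hwb.ne], by simp [h4, h5], ?_⟩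
    intro s hs y hy
    rcases List.mem_cons.mp hs with rfl | hs
    · rcases hb y hy with h | h | h <;> simp [h]
    · rcases h6 s hs y hy with h | h | h <;> simp [h]
  | swap h ih =>
    obtain ⟨h1, h2, h3, h4, h5, h6⟩ := ih
    exact ⟨h1, h2.symm, h4, h3, h5, fun s hs y hy => by have := h6 s hs y hy; tauto⟩

theorem Half.exists_side {u a b : V} {S : List V} (h : Half G u a b S) :
    ∃ j, Side G j a b S ∨ Side G j b a S := by
  induction h with
  | base hua hub hab hu =>
    exact ⟨0, .inl (.base (by simp) (by simp) ⟨hub.symm, by simp, trivial⟩ (by simpa using hua))⟩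
  | @push a b w S h hwa hwb hw hb ih =>
    obtain ⟨j, hj⟩ := ih
    obtain ⟨h1, h2, h3, h4, h5, h6⟩ := h.basic
    rcases hj with hj | hj
    · obtain ⟨j', hj'⟩ := hj.shift (.inl ⟨rfl, rfl⟩) h2 hwa hwb h3 h4 hw h6
      exact ⟨j', .inl hj'⟩
    · obtain ⟨j', hj'⟩ := hj.shift (.inr ⟨rfl, rfl⟩) h2 hwa hwb h3 h4 hw h6
      exact ⟨j', .inl hj'⟩
  | swap h ih =>
    obtain ⟨j, hj⟩ := ih
    exact ⟨j, hj.symm⟩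

/-- The level function of a side, with the set of vertices at which a higher level can be left
while staying on a side. -/
theorem Side.exists_level [DecidableEq V] {j : ℕ} {c x : V} {S : List V}
    (h : Side G j c x S) : ∃ (F : V → ℕ) (z : V) (Z : Finset V),
      (∀ v, F v = 0 ↔ v ∉ S) ∧ (∀ v ∈ S, ∀ y, G.Adj v y → F v ≤ F y + 1) ∧ F z = j + 1 ∧
      (∀ v, F v ≤ j + 1) ∧
      Z.card ≤ 2 * j ∧ (∀ v ∈ Z, v ∈ S) ∧ z ∉ Z ∧
      ∀ p q, G.Adj p q → F p = F q + 1 → 1 ≤ F q → q ∈ Z := by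
  induction h with
  | @base c x l hne hl hp hc =>
    obtain ⟨z, hz⟩ := List.exists_mem_of_ne_nil l hne
    refine ⟨fun v => if v ∈ l then 1 else 0, z, ∅, ?_, ?_, ?_, ?_, by simp, by simp, by simp, ?_⟩
    · intro v; by_cases hv : v ∈ l <;> simp [hv]
    · intro v hv y _; simp [hv]
    · simp [hz]
    · intro v; dsimp only; split_ifs <;> omega
    · intro p q _ hpq hq
      dsimp only at hpq hq
      split_ifs at hpq hq <;> omega
  | @step j c x c' x' l₀ l S hS hlast hl hp hc hcl ih =>
    obtain ⟨F, z, Z, h1, h2, h3, h4, h5, h6, h7, h8⟩ := ih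
    have hc' : c' ∈ l := by rcases hlast with rfl | rfl <;> simp
    have hx' : x' ∈ l := by rcases hlast with rfl | rfl <;> simp
    have hz : z ∈ S := by by_contra hz; rw [← h1, h3] at hz; omega
    have hS0 : ∀ v ∉ S, F v = 0 := fun v hv => (h1 v).2 hv
    have hdis : ∀ v ∈ S, v ∉ l := fun v hv hvl => (List.nodup_append.mp hl).2.2 v hvl v hv rfl
    refine ⟨fun v => (if v ∈ l ++ S then 1 else 0) + F v, z, insert c' (insert x' Z),
      ?_, ?_, ?_, ?_, ?_, ?_, ?_, ?_⟩
    · intro v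
      by_cases hv : v ∈ l ++ S
      · simp only [hv, if_true, not_true, iff_false]; omega
      · have : v ∉ S := fun h => hv (by simp [h])
        simp only [hv, if_false, not_false_eq_true, hS0 v this]
    · intro v hv y hvy
      by_cases hvS : v ∈ S
      · have hy : y ∈ l ++ S := by
          rcases hcl v hvS y hvy with h | rfl | rfl <;> simp [*]
        have := h2 v hvS y hvy
        simp only [hv, hy, if_true]; omega
      · simp only [hv, if_true, hS0 v hvS]; omega
    · simp [hz, h3, add_comm]
    · intro v
      have := h4 v
      dsimp only; split_ifs <;> omega
    · have a1 := Finset.card_insert_le c' (insert x' Z)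
      have a2 := Finset.card_insert_le x' Z
      omega
    · intro v hv
      simp only [Finset.mem_insert] at hv
      rcases hv with rfl | rfl | hv
      · simp [hc']
      · simp [hx']
      · simp [h6 v hv]
    · simp only [Finset.mem_insert, not_or]
      exact ⟨fun h => hdis z hz (h ▸ hc'), fun h => hdis z hz (h ▸ hx'), h7⟩
    · intro p q hpq hF hq
      have hqm : q ∈ l ++ S := by
        by_contra hqm
        have : q ∉ S := fun h => hqm (by simp [h])
        simp only [hqm, if_false, hS0 q this] at hq
        omega
      simp only [hqm, if_true] at hF
      have hpS : p ∈ S := by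
        by_contra hpS
        rw [hS0 p hpS] at hF
        split_ifs at hF <;> omega
      simp only [List.mem_append, hpS, or_true, if_true] at hF
      simp only [Finset.mem_insert]
      by_cases hqS : q ∈ S
      · have : F q ≠ 0 := fun h => (h1 q).1 h hqS
        exact .inr (.inr (h8 p q hpq (by omega) (by omega)))
      · rcases hcl p hpS q hpq with h | h | h
        · exact absurd h hqS
        · exact .inl h
        · exact .inr (.inl h)

theorem edist_le_add {x y z : V} {k m n : ℕ} (h₁ : G.edist x y ≤ k) (h₂ : G.edist y z ≤ m)
    (h : k + m ≤ n) : G.edist x z ≤ n :=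
  SimpleGraph.edist_triangle.trans ((add_le_add h₁ h₂).trans (by exact_mod_cast h))

theorem edist_le_one_of_adj {x y : V} (h : G.Adj x y) : G.edist x y ≤ (1 : ℕ) := by
  rw [SimpleGraph.edist_eq_one_iff_adj.mpr h]; rfl

theorem edist_mono {x y : V} {k m : ℕ} (h₁ : G.edist x y ≤ k) (h : k ≤ m) : G.edist x y ≤ m :=
  h₁.trans (by exact_mod_cast h)

theorem Side.edist_le {j : ℕ} {c x : V} {S : List V} (h : Side G j c x S) :
    (∀ z ∈ S, G.edist z c ≤ (j + 1 : ℕ)) ∧ ∀ z ∈ S, ∀ w ∈ S, G.edist z w ≤ (j + 2 : ℕ) := by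
  induction h with
  | @base c x l hne hl hp hc =>
    refine ⟨fun z hz => edist_le_one_of_adj (hc z hz), fun z hz w hw => ?_⟩
    exact edist_le_add (edist_le_one_of_adj (hc z hz)) (edist_le_one_of_adj (hc w hw).symm) le_rfl
  | @step j c x c' x' l₀ l S hS hlast hl hp hc hcl ih =>
    have hc' : c' ∈ l := by rcases hlast with rfl | rfl <;> simp
    have key : ∀ z ∈ l ++ S, G.edist z c ≤ (j + 1 + 1 : ℕ) := by
      intro z hz
      rcases List.mem_append.mp hz with hz | hz
      · exact edist_mono (edist_le_one_of_adj (hc z hz)) (by omega)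
      · exact edist_le_add (ih.1 z hz) (edist_le_one_of_adj (hc c' hc')) le_rfl
    refine ⟨key, fun z hz w hw => ?_⟩
    rcases List.mem_append.mp hz with hz' | hz'
    · rw [SimpleGraph.edist_comm]
      exact edist_le_add (key w hw) (edist_le_one_of_adj (hc z hz').symm) (by omega)
    · rcases List.mem_append.mp hw with hw' | hw'
      · exact edist_le_add (key z hz) (edist_le_one_of_adj (hc w hw').symm) (by omega)
      · exact edist_mono (ih.2 z hz' w hw') (by omega)

theorem le_add_diam (hG : G.ediam ≠ ⊤) {f : V → ℕ} (hf : ∀ x y, G.Adj x y → f x ≤ f y + 1)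
    (x y : V) : f x ≤ f y + G.diam := by
  have : Nonempty V := ⟨x⟩
  obtain ⟨p, hp⟩ := (SimpleGraph.connected_of_ediam_ne_top hG).exists_walk_length_eq_dist x y
  have : ∀ {x y : V} (p : G.Walk x y), f x ≤ f y + p.length := by
    intro x y p
    induction p with
    | nil => simp
    | cons h p ih =>
      have := hf _ _ h
      rw [SimpleGraph.Walk.length_cons]; omega
  have h1 := this p
  have h2 := SimpleGraph.dist_le_diam hG (u := x) (v := y)
  omega

/-- The edge `a b` splits the graph into the part `S` with end `u` and the part `T` with
end `u'`. -/
structure Zip (G : SimpleGraph V) (u u' a b : V) (S T : List V) : Prop where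
  left : Half G u a b S
  right : Half G u' a b T
  disj : ∀ v ∈ S, v ∉ T
  cover : ∀ v, v = a ∨ v = b ∨ v ∈ S ∨ v ∈ T

theorem Zip.symm {u u' a b : V} {S T : List V} (h : Zip G u u' a b S T) :
    Zip G u' u a b T S :=
  ⟨h.right, h.left, fun v hT hS => h.disj v hS hT, fun v => by have := h.cover v; tauto⟩

theorem Zip.swap {u u' a b : V} {S T : List V} (h : Zip G u u' a b S T) :
    Zip G u u' b a S T :=
  ⟨h.left.swap, h.right.swap, h.disj, fun v => by have := h.cover v; tauto⟩

theorem Half.unzip {u u' a b : V} {S : List V} (h : Half G u a b S) (T : List V)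
    (hz : Zip G u u' a b S T) :
    (∃ a' b' T', Zip G u u' a' b' [u] T') ∧
      ∀ r ∈ S, r = u ∨ ∃ a' b' S' T', Zip G u u' a' b' S' T' ∧ (r = a' ∨ r = b') := by
  induction h generalizing T with
  | base hua hub hab hu => exact ⟨⟨_, _, _, hz⟩, fun r hr => .inl (by simpa using hr)⟩
  | @push a b w S h hwa hwb hw hb ih =>
    obtain ⟨h1, h2, h3, h4, h5, h6⟩ := h.basic
    have hz' : Zip G u u' a b S (w :: T) := by
      refine ⟨h, .push hz.right h2.symm hwb.symm (hz.disj b (by simp)) fun x hx => ?_,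
        fun v hv => ?_, fun v => ?_⟩
      · rcases hz.cover x with rfl | rfl | hxS | hxT
        · simp
        · exact absurd rfl hx.ne
        · rcases List.mem_cons.mp hxS with rfl | hxS
          · simp
          · rcases h6 x hxS w hx.symm with h | rfl | rfl
            · exact absurd h hw
            · exact absurd rfl hwa.ne
            · exact absurd rfl hwb.ne
        · exact .inl hxT
      · have := hz.disj v (by simp [hv])
        have : v ≠ w := fun h => hw (h ▸ hv)
        simp [*]
      · have := hz.cover v
        simp only [List.mem_cons] at this ⊢
        tauto
    obtain ⟨i1, i2⟩ := ih _ hz'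
    refine ⟨i1, fun r hr => ?_⟩
    rcases List.mem_cons.mp hr with rfl | hr
    · exact .inr ⟨_, _, _, _, hz', .inr rfl⟩
    · exact i2 r hr
  | swap h ih => exact ih T hz.swap

theorem Zip.cases_root {u u' a b : V} {S T : List V} (h : Zip G u u' a b S T) (r : V) :
    r = u ∨ r = u' ∨ ∃ a' b' S' T', Zip G u u' a' b' S' T' ∧ r = a' := by
  have key : ∀ {u u' : V}, (∃ a' b' S' T', Zip G u u' a' b' S' T' ∧ (r = a' ∨ r = b')) →
      ∃ a' b' S' T', Zip G u u' a' b' S' T' ∧ r = a' := by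
    rintro u u' ⟨a', b', S', T', hz, h | h⟩
    · exact ⟨_, _, _, _, hz, h⟩
    · exact ⟨_, _, _, _, hz.swap, h⟩
  rcases h.cover r with hr | hr | hr | hr
  · exact .inr (.inr ⟨_, _, _, _, h, hr⟩)
  · exact .inr (.inr ⟨_, _, _, _, h.swap, hr⟩)
  · rcases (h.left.unzip T h).2 r hr with h1 | h1
    · exact .inl h1
    · exact .inr (.inr (key h1))
  · rcases (h.right.unzip S h.symm).2 r hr with h1 | h1
    · exact .inr (.inl h1)
    · obtain ⟨a', b', S', T', hz, hr⟩ := key h1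
      exact .inr (.inr ⟨_, _, _, _, hz.symm, hr⟩)

theorem Half.exists_ends {u a b : V} {S : List V} (h : Half G u a b S) :
    ∃ p q, G.Adj u p ∧ G.Adj u q ∧ G.Adj p q ∧ ∀ x, G.Adj u x → x = p ∨ x = q := by
  induction h with
  | base hua hub hab hu => exact ⟨_, _, hua, hub, hab, hu⟩
  | push _ _ _ _ _ ih => exact ih
  | swap _ ih => exact ih

theorem Half.adj_of_singleton {u a b : V} {S : List V} (h : Half G u a b S) (hS : S = [u]) :
    G.Adj u a ∧ G.Adj u b := by
  induction h with
  | base hua hub hab hu => exact ⟨hua, hub⟩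
  | push h _ _ _ _ ih =>
    have := h.basic.1
    simp at hS
    simp [hS.2] at this
  | swap _ ih => exact (ih hS).symm

theorem Half.of_induce {v : V} {u a b : {w : V | w ≠ v}} {S : List {w : V | w ≠ v}}
    (h : Half (G.induce {w : V | w ≠ v}) u a b S) (hv : ∀ s ∈ S, ¬ G.Adj s v) :
    Half G u a b (S.map Subtype.val) := by
  induction h with
  | @base a b hua hub hab hu =>
    refine .base hua hub hab fun x hx => ?_
    have hxv : x ≠ v := fun h => hv u (by simp) (h ▸ hx)
    rcases hu ⟨x, hxv⟩ hx with h | h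
    · exact .inl (congrArg Subtype.val h)
    · exact .inr (congrArg Subtype.val h)
  | @push a b w S h hwa hwb hw hb ih =>
    refine .push (ih fun s hs => hv s (by simp [hs])) hwa hwb ?_ fun x hx => ?_
    · intro hm
      obtain ⟨y, hy, hyw⟩ := List.mem_map.mp hm
      exact hw (Subtype.ext hyw ▸ hy)
    · have hxv : x ≠ v := fun h => hv b (by simp) (h ▸ hx)
      rcases hb ⟨x, hxv⟩ hx with h | h | h
      · exact .inl (List.mem_map.mpr ⟨_, h, rfl⟩)
      · exact .inr (.inl (congrArg Subtype.val h))
      · exact .inr (.inr (congrArg Subtype.val h))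
  | swap _ ih => exact .swap (ih hv)

theorem Zip.extend {v : V} {u u' a b : {w : V | w ≠ v}} {S : List {w : V | w ≠ v}}
    (h : Zip (G.induce {w : V | w ≠ v}) u u' a b S [u'])
    (hN : ∀ x, G.Adj v x ↔ x = u' ∨ x = a) :
    Zip G u v a u' (b :: S.map Subtype.val) [v] := by
  obtain ⟨h1, h2, h3, h4, h5, h6⟩ := h.left.basic
  obtain ⟨ha, hb⟩ := h.right.adj_of_singleton rfl
  have hu'S : u' ∉ S := fun hm => h.disj _ hm (by simp)
  have hSv : ∀ s ∈ S, ¬ G.Adj s v := by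
    intro s hs hsv
    rcases (hN s).1 hsv.symm with h | h
    · exact hu'S (Subtype.ext h ▸ hs)
    · exact h3 (Subtype.ext h ▸ hs)
  have hval : ∀ y : {w : V | w ≠ v}, (y : V) ∈ S.map Subtype.val ↔ y ∈ S := fun y =>
    ⟨fun hy => by
      obtain ⟨z, hz, he⟩ := List.mem_map.mp hy
      exact Subtype.ext he ▸ hz, fun hy => List.mem_map.mpr ⟨y, hy, rfl⟩⟩
  refine ⟨.push (h.left.of_induce hSv) ha hb (by rwa [hval]) fun x hx => ?_, ?_, ?_, ?_⟩
  · have hxv : x ≠ v := by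
      rintro rfl
      rcases (hN b).1 hx.symm with h | h
      · exact hb.ne' (Subtype.ext h)
      · exact h2.ne' (Subtype.ext h)
    rcases h.cover ⟨x, hxv⟩ with h | h | h | h
    · exact .inr (.inl (congrArg Subtype.val h))
    · exact absurd (congrArg Subtype.val h).symm hx.ne
    · exact .inl ((hval ⟨x, hxv⟩).2 h)
    · exact .inr (.inr (congrArg Subtype.val (List.mem_singleton.mp h)))
  · refine .base ((hN _).2 (.inr rfl)) ((hN _).2 (.inl rfl)) ha.symm fun x hx => ?_
    exact ((hN x).1 hx).symm
  · intro y hy hyv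
    rw [List.mem_singleton] at hyv
    subst hyv
    rcases List.mem_cons.mp hy with h | h
    · exact b.2 h.symm
    · obtain ⟨z, -, hz⟩ := List.mem_map.mp h
      exact z.2 hz
  · intro x
    by_cases hxv : x = v
    · simp [hxv]
    · rcases h.cover ⟨x, hxv⟩ with h | h | h | h
      · exact .inl (congrArg Subtype.val h)
      · exact .inr (.inr (.inl (by simp [← congrArg Subtype.val h])))
      · exact .inr (.inr (.inl (List.mem_cons_of_mem _ ((hval ⟨x, hxv⟩).2 h))))
      · exact .inr (.inl (congrArg Subtype.val (List.mem_singleton.mp h)))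

/-- A 2-path is `K₂`, `K₃`, or splits along an edge into two parts with one end each. -/
theorem exists_zip {V : Type} {G : SimpleGraph V} (hG : IsTwoPath G) :
    (∃ p q, G.Adj p q ∧ ∀ v, v = p ∨ v = q) ∨
    (∃ p q r, G.Adj p q ∧ G.Adj p r ∧ G.Adj q r ∧ ∀ v, v = p ∨ v = q ∨ v = r) ∨
    ∃ u u' a b S T, Zip G u u' a b S T := by
  induction hG with
  | complete2 G hc hadj =>
    obtain ⟨x, y, hxy, hu⟩ := Nat.card_eq_two_iff.mp hc
    refine .inl ⟨x, y, hadj _ _ hxy, fun v => ?_⟩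
    have : v ∈ ({x, y} : Set _) := hu ▸ Set.mem_univ v
    simpa using this
  | complete3 G hc hadj =>
    rw [← Set.ncard_univ, Set.ncard_eq_three] at hc
    obtain ⟨x, y, z, hxy, hxz, hyz, hu⟩ := hc
    refine .inr (.inl ⟨x, y, z, hadj _ _ hxy, hadj _ _ hxz, hadj _ _ hyz, fun v => ?_⟩)
    have : v ∈ ({x, y, z} : Set _) := hu ▸ Set.mem_univ v
    simpa using this
  | @extend V G u₀ v hne hset hcard hsimp hrec ih =>
    obtain ⟨α, β, hαβ, hNv⟩ := Set.ncard_eq_two.mp hcard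
    have hN : ∀ x, G.Adj v x ↔ x = α ∨ x = β := fun x => by
      rw [← SimpleGraph.mem_neighborSet, hNv]; simp
    have hvα : G.Adj v α := (hN α).2 (.inl rfl)
    have hvβ : G.Adj v β := (hN β).2 (.inr rfl)
    have hadj : G.Adj α β := hsimp α β hvα hvβ hαβ
    rcases ih with ⟨⟨p, hp⟩, ⟨q, hq⟩, hpq, hcov⟩ | ⟨⟨p, hp⟩, ⟨q, hq⟩, ⟨r, hr⟩, hpq, hpr, hqr, hcov⟩ |
        ⟨u, u', a, b, S, T, hz⟩
    · refine .inr (.inl ⟨v, α, β, hvα, hvβ, hadj, fun x => ?_⟩)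
      have h1 := hcov ⟨α, hvα.ne'⟩
      have h2 := hcov ⟨β, hvβ.ne'⟩
      by_cases hx : x = v
      · exact .inl hx
      · have h3 := hcov ⟨x, hx⟩
        simp only [Subtype.mk.injEq] at h1 h2 h3
        grind
    · have key : ∀ γ, γ ≠ v → γ ≠ α → γ ≠ β → G.Adj γ α → G.Adj γ β →
          (∀ x, x ≠ v → x = α ∨ x = β ∨ x = γ) → ∃ u u' a b S T, Zip G u u' a b S T := by
        intro γ hγv h1 h2 h3 h4 hc
        have hγ : ¬ G.Adj γ v := fun h => by
          rcases (hN γ).1 h.symm with h | h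
          · exact h1 h
          · exact h2 h
        refine ⟨γ, v, α, β, [γ], [v], .base h3 h4 hadj fun x hx => ?_,
          .base hvα hvβ hadj fun x hx => (hN x).1 hx, by simpa using hγv, fun x => ?_⟩
        · have := hc x fun h => hγ (h ▸ hx)
          have := hx.ne'
          tauto
        · by_cases hx : x = v
          · simp [hx]
          · rcases hc x hx with h | h | h <;> simp [h]
      have h1 := hcov ⟨α, hvα.ne'⟩
      have h2 := hcov ⟨β, hvβ.ne'⟩
      have h3 : ∀ x, x ≠ v → x = p ∨ x = q ∨ x = r := fun x hx => by
        simpa using hcov ⟨x, hx⟩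
      simp only [Subtype.mk.injEq] at h1 h2
      replace hpq : G.Adj p q := hpq
      replace hpr : G.Adj p r := hpr
      replace hqr : G.Adj q r := hqr
      refine .inr (.inr ?_)
      rcases h1 with rfl | rfl | rfl <;> rcases h2 with rfl | rfl | rfl
      · exact absurd rfl hαβ
      · exact key r hr hpr.ne' hqr.ne' hpr.symm hqr.symm fun x hx => by have := h3 x hx; tauto
      · exact key q hq hpq.ne' hqr.ne hpq.symm hqr fun x hx => by have := h3 x hx; tauto
      · exact key r hr hqr.ne' hpr.ne' hqr.symm hpr.symm fun x hx => by have := h3 x hx; tauto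
      · exact absurd rfl hαβ
      · exact key p hp hpq.ne hpr.ne hpq hpr fun x hx => by have := h3 x hx; tauto
      · exact key q hq hqr.ne hpq.ne' hqr hpq.symm fun x hx => by have := h3 x hx; tauto
      · exact key p hp hpr.ne hpq.ne hpr hpq fun x hx => by have := h3 x hx; tauto
      · exact absurd rfl hαβ
    · refine .inr (.inr ?_)
      have hsim : ∀ {u a b S}, Half (G.induce {w : V | w ≠ v}) u a b S → ¬ G.Adj v u →
          (u : V) = u₀ := by
        intro u a b S h hvu
        obtain ⟨p, q, -, -, hpq, hx⟩ := h.exists_ends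
        have hlift : ∀ y, G.Adj u y → y = p ∨ y = q := by
          intro y hy
          have hyv : y ≠ v := fun h => hvu (h ▸ hy).symm
          rcases hx ⟨y, hyv⟩ hy with h | h
          · exact .inl (congrArg Subtype.val h)
          · exact .inr (congrArg Subtype.val h)
        have hmem : (u : V) ∈ {w : V | IsSimplicial G w} := by
          intro y z hy hz hyz
          rcases hlift y hy with rfl | rfl <;> rcases hlift z hz with rfl | rfl
          · exact absurd rfl hyz
          · exact hpq
          · exact hpq.symm
          · exact absurd rfl hyz
        rw [hset] at hmem
        rcases hmem with h | h
        · exact h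
        · exact absurd h u.2
      have main : ∀ {u u' a b S T}, Zip (G.induce {w : V | w ≠ v}) u u' a b S T → G.Adj v u' →
          ∃ u u' a b S T, Zip G u u' a b S T := by
        intro u u' a b S T hz hvu'
        obtain ⟨⟨a, b, S, hz⟩, -⟩ := hz.right.unzip S hz.symm
        replace hz := hz.symm
        obtain ⟨y, hy, hyN⟩ : ∃ y, G.Adj u' y ∧ ∀ x, G.Adj v x ↔ x = u' ∨ x = y := by
          rcases (hN u').1 hvu' with h | h
          · exact ⟨β, h ▸ hadj, fun x => by rw [hN, h]⟩
          · exact ⟨α, h ▸ hadj.symm, fun x => by rw [hN, h, or_comm]⟩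
        have hyv : y ≠ v := ((hyN y).2 (.inr rfl)).ne'
        rcases hz.right.basic.2.2.2.2.2 u' (by simp) ⟨y, hyv⟩ hy with h | h | h
        · exact absurd (congrArg Subtype.val (List.mem_singleton.mp h)).symm hy.ne
        · obtain rfl : y = a := congrArg Subtype.val h
          exact ⟨_, _, _, _, _, _, hz.extend hyN⟩
        · obtain rfl : y = b := congrArg Subtype.val h
          exact ⟨_, _, _, _, _, _, hz.swap.extend hyN⟩
      by_cases hvu' : G.Adj v u'
      · exact main hz hvu'
      by_cases hvu : G.Adj v u
      · exact main hz.symm hvu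
      have : u = u' := Subtype.ext ((hsim hz.left hvu).trans (hsim hz.right hvu').symm)
      exact absurd hz.right.basic.1 (hz.disj u' (this ▸ hz.left.basic.1))

theorem two_pow_add_le {e d : ℕ} (he : 1 ≤ e) (h : e ≤ d) : 2 ^ e + 2 * d ≤ 2 ^ d + 2 * e := by
  induction d, h using Nat.le_induction with
  | base => exact le_rfl
  | succ d hd ih =>
    have : 2 ≤ 2 ^ d := Nat.le_self_pow (by omega) 2
    rw [pow_succ]; omega

theorem sum_cut_cons [Fintype V] [DecidableEq V] {a : V} {S : List V} (h : (a :: S).Nodup)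
    (C : V → ℕ) : ∑ v, cut (a :: S) C v = C a + ∑ v, cut S C v := by
  rw [cut_cons h, sum_add_apply, sum_single]

theorem card_eq_length [Fintype V] {S : List V} (h : S.Nodup) (hc : ∀ v, v ∈ S) :
    Fintype.card V = S.length := by
  classical
  rw [← sum_cut_one h, cut_eq_self fun v hv => absurd (hc v) hv]
  simp

theorem single_le [DecidableEq V] {C : V → ℕ} {v : V} {k : ℕ} (h : k ≤ C v) :
    (Pi.single v k : V → ℕ) ≤ C := by
  intro y
  by_cases hy : y = v
  · subst hy; simpa using h
  · simp [hy]

theorem solvable_of_two_le [DecidableEq V] {C : V → ℕ} {v r : V} (hr : G.Adj v r)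
    (h : 2 ≤ C v) : Solvable G C (Pi.single r 1) :=
  solvable_mono (solvable_single_of_adj hr) (single_le h) le_rfl

/-- A solution for `r` that uses at most `k` pebbles. -/
def Cheap [Fintype V] [DecidableEq V] (G : SimpleGraph V) (k : ℕ) (r : V) (C : V → ℕ) : Prop :=
  ∃ C₀ ≤ C, ∑ v, C₀ v ≤ k ∧ Solvable G C₀ (Pi.single r 1)

theorem Cheap.solvable [Fintype V] [DecidableEq V] {k : ℕ} {r : V} {C : V → ℕ}
    (h : Cheap G k r C) : Solvable G C (Pi.single r 1) :=
  let ⟨_, h1, _, h3⟩ := h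
  solvable_mono h3 h1 le_rfl

theorem cheap_of_two_le [Fintype V] [DecidableEq V] {C : V → ℕ} {v r : V} {k : ℕ}
    (hk : 2 ≤ k) (hr : G.Adj v r) (h : 2 ≤ C v) : Cheap G k r C :=
  ⟨_, single_le h, by rwa [sum_single], solvable_single_of_adj hr⟩

theorem cheap_of_one_le [Fintype V] [DecidableEq V] {C : V → ℕ} {r : V} {k : ℕ}
    (hk : 1 ≤ k) (h : 1 ≤ C r) : Cheap G k r C :=
  ⟨_, single_le h, by rwa [sum_single], solvable_of_le le_rfl⟩

/-- The bounds on the number of pebbles needed for a first solution at `r`, and for a first cheap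
solution at `r`. -/
structure RootBound [Fintype V] [DecidableEq V] (G : SimpleGraph V) (d : ℕ) (r : V) : Prop where
  solvable : ∀ C : V → ℕ, 2 ^ d + Fintype.card V ≤ ∑ v, C v + 2 * d →
    Solvable G C (Pi.single r 1)
  cheap : ∀ C : V → ℕ, 2 * 2 ^ d + Fintype.card V ≤ ∑ v, C v + 2 * d → Cheap G (2 ^ d) r C

theorem rootBound_of_forall_adj [Fintype V] [DecidableEq V] {r : V}
    (h : ∀ v, v ≠ r → G.Adj v r) : RootBound G 1 r := by
  have key : ∀ C : V → ℕ, Fintype.card V ≤ ∑ v, C v → Cheap G (2 ^ 1) r C := by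
    intro C hC
    by_cases hr : 1 ≤ C r
    · exact cheap_of_one_le (by norm_num) hr
    by_cases hv : ∃ v, 2 ≤ C v
    · obtain ⟨v, hv⟩ := hv
      exact cheap_of_two_le (by norm_num) (h v (by rintro rfl; omega)) hv
    · push Not at hv
      have : ∑ v, C v < ∑ v : V, 1 :=
        Finset.sum_lt_sum (fun v _ => by have := hv v; omega) ⟨r, Finset.mem_univ r, by omega⟩
      simp at this
      omega
  exact ⟨fun C hC => (key C (by omega)).solvable, fun C hC => key C (by omega)⟩

theorem rootBound_of_end [Fintype V] [DecidableEq V] {j d : ℕ} {r c x : V} {S : List V}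
    (h : Side G j c x S) (hc : G.Adj c r) (hx : G.Adj x r) (hn : (r :: c :: x :: S).Nodup)
    (hcov : ∀ v, v ∈ r :: c :: x :: S) (hd : j + 2 ≤ d) : RootBound G d r := by
  have hcard := card_eq_length hn hcov
  simp only [List.length_cons] at hcard
  have hdec : ∀ C : V → ℕ, C = Pi.single r (C r) + (Pi.single c (C c) +
      (Pi.single x (C x) + cut S C)) := by
    intro C
    rw [← cut_cons hn.of_cons.of_cons, ← cut_cons hn.of_cons, ← cut_cons hn,
      cut_eq_self fun v hv => absurd (hcov v) hv]
  have hsum : ∀ C : V → ℕ, ∑ v, C v = C r + (C c + (C x + ∑ v, cut S C v)) := by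
    intro C
    conv_lhs => rw [hdec C]
    simp only [sum_add_apply, sum_single]
  have hp1 := two_pow_add_le (by omega) hd
  have hK : 2 ≤ 2 ^ (j + 1) := Nat.le_self_pow (by omega) 2
  have hpow : 2 ^ (j + 2) = 2 * 2 ^ (j + 1) := by ring
  have hmono : 2 ^ (j + 2) ≤ 2 ^ d := Nat.pow_le_pow_right (by norm_num) hd
  rw [hpow] at hp1 hmono
  refine ⟨fun C hC => ?_, fun C hC => ?_⟩
  · rw [hsum, hcard] at hC
    by_cases hr1 : 1 ≤ C r
    · exact solvable_of_le (single_le hr1)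
    by_cases hc2 : 2 ≤ C c
    · exact solvable_of_two_le hc hc2
    by_cases hx2 : 2 ≤ C x
    · exact solvable_of_two_le hx hx2
    obtain ⟨s, hs, hb, hf⟩ := exists_solvable_of_side h (cut S C) fun v hv => cut_of_not_mem hv C
    have key : ∀ Y, Solvable G (cut S C) Y →
        Solvable G C (Pi.single c (C c) + (Pi.single x (C x) + Y)) := by
      intro Y hY
      have h1 := solvable_add (solvable_of_le (G := G) (le_refl (Pi.single c (C c))))
        (solvable_add (solvable_of_le (G := G) (le_refl (Pi.single x (C x)))) hY)
      refine solvable_mono h1 ?_ le_rfl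
      conv_rhs => rw [hdec C]
      exact le_add_self
    by_cases hsc : 2 ≤ s + C c
    · refine solvable_trans (key _ hs) (solvable_of_two_le hc ?_)
      simp only [Pi.add_apply, Pi.single_eq_same]; omega
    by_cases htight : s = 1 ∧ C x = 1 ∧
        ∑ v, cut S C v + 2 * (j + 1) = S.length + 2 ^ (j + 1) * (s + 1)
    · refine solvable_trans (key _ (hf htight.2.2 0 htight.1)) (solvable_of_two_le hx ?_)
      simp only [Pi.add_apply, Pi.single_eq_same]; omega
    · exfalso
      have hs2 : s = 0 ∨ s = 1 := by omega
      rcases hs2 with rfl | rfl <;> omega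
  · rw [hsum, hcard] at hC
    by_cases hr1 : 1 ≤ C r
    · exact cheap_of_one_le (by omega) hr1
    by_cases hc2 : 2 ≤ C c
    · exact cheap_of_two_le (by omega) hc hc2
    by_cases hx2 : 2 ≤ C x
    · exact cheap_of_two_le (by omega) hx hx2
    have hj : j + 1 < 2 ^ (j + 1) := Nat.lt_two_pow_self
    obtain ⟨C₀, h1, h2, h3⟩ := exists_cheap_two (fun C hC hs => h.exists_cheap C hC hs)
      (cut S C) (fun v hv => cut_of_not_mem hv C) (by omega)
    exact ⟨C₀, h1.trans (cut_le S C), by omega, solvable_trans h3 (solvable_single_of_adj hc)⟩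

theorem solvable_of_thin [Fintype V] [DecidableEq V] {j d : ℕ} {r i c x c' x' : V} {S T : List V}
    (hri : G.Adj r i) (hL : Side G j c x S) (hcx : c = r ∧ x = i ∨ c = i ∧ x = r)
    (hR : Side G 0 c' x' T) (hcx' : c' = r ∧ x' = i ∨ c' = i ∧ x' = r)
    (hn : (r :: i :: (S ++ T)).Nodup) (hcov : ∀ v, v ∈ r :: i :: (S ++ T))
    (hcl : ∀ s ∈ S, ∀ y, G.Adj s y → y ∈ S ∨ y = r ∨ y = i)
    (hd : ∀ f : V → ℕ, (∀ p q, G.Adj p q → f p ≤ f q + 1) → ∀ p q, f p ≤ f q + d)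
    (C : V → ℕ) (hC : 2 ^ d + Fintype.card V ≤ ∑ v, C v + 2 * d) :
    Solvable G C (Pi.single r 1) := by
  have hcard := card_eq_length hn hcov
  simp only [List.length_cons, List.length_append] at hcard
  have hdec : C = Pi.single r (C r) + (Pi.single i (C i) + (cut S C + cut T C)) := by
    rw [← cut_append hn.of_cons.of_cons, ← cut_cons hn.of_cons, ← cut_cons hn,
      cut_eq_self fun v hv => absurd (hcov v) hv]
  have hsum : ∑ v, C v = C r + (C i + (∑ v, cut S C v + ∑ v, cut T C v)) := by
    conv_lhs => rw [hdec]
    simp only [sum_add_apply, sum_single]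
  rw [hsum, hcard] at hC
  cases hR with
  | base hne hl hp hc =>
  obtain ⟨w, T', rfl⟩ := List.exists_cons_of_ne_nil hne
  have hn2 := hn.of_cons.of_cons
  have hST : ∀ s ∈ S, s ∉ w :: T' := fun s h1 h2 => (List.nodup_append.mp hn2).2.2 s h1 s h2 rfl
  have hrn : r ≠ i ∧ r ∉ S ∧ r ∉ w :: T' := by
    have := (List.nodup_cons.mp hn).1
    simp only [List.mem_cons, List.mem_append, not_or] at this ⊢
    exact this
  have hin : i ∉ S ∧ i ∉ w :: T' := by
    have := (List.nodup_cons.mp hn.of_cons).1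
    simp only [List.mem_cons, List.mem_append, not_or] at this ⊢
    exact this
  have hw : G.Adj w r ∧ G.Adj w i := by
    rcases hcx' with ⟨rfl, rfl⟩ | ⟨rfl, rfl⟩
    · exact ⟨hc w (by simp), hp.1.symm⟩
    · exact ⟨hp.1.symm, hc w (by simp)⟩
  obtain ⟨j', hj'⟩ := hL.shift hcx hri hw.1 hw.2 hrn.2.1 hin.1
    (fun h => hST w h (by simp)) hcl
  have hjd : j' + 1 ≤ d := by
    obtain ⟨F, z, -, h1, h2, h3, -⟩ := hj'.exists_level
    have h4 := hd F (fun p q hpq => ?_) z r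
    · have : F r = 0 := (h1 r).2 (by simp [hrn.1, hrn.2.1])
      omega
    · by_cases hpS : p ∈ i :: S
      · exact h2 p hpS q hpq
      · rw [(h1 p).2 hpS]; omega
  have hE : ∀ C : V → ℕ, (∀ v ∉ i :: S, C v = 0) → ¬ Solvable G C (Pi.single r 1) →
      ∑ v, C v + 2 * d ≤ S.length + 1 + 2 ^ d := by
    intro C hC hns
    obtain ⟨s, hs, hb, -⟩ := exists_solvable_of_side hj' C hC
    have hs0 : s = 0 := by
      by_contra h
      exact hns (solvable_mono hs le_rfl (single_le (by rw [Pi.single_eq_same]; omega)))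
    have := two_pow_add_le (by omega) hjd
    rw [hs0, List.length_cons] at hb
    omega
  by_contra hns
  have hr0 : C r = 0 := by
    by_contra h
    exact hns (solvable_of_le (single_le (by omega)))
  have h1 := hE (cut (i :: S) C) (fun v hv => cut_of_not_mem hv C) fun h =>
    hns (solvable_mono h (cut_le _ _) le_rfl)
  have hiS : (i :: S).Nodup := List.nodup_cons.mpr ⟨hin.1, (List.nodup_append.mp hn2).1⟩
  rw [sum_cut_cons hiS] at h1
  obtain ⟨y, hyT, hy⟩ : ∃ y ∈ w :: T', 2 ≤ C y := by
    by_contra! h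
    have := sum_cut_le hl (C := C) (k := 1) fun v hv => by have := h v hv; omega
    omega
  rcases hcx' with ⟨rfl, rfl⟩ | ⟨rfl, rfl⟩
  · exact hns (solvable_of_two_le (hc y hyT) hy)
  have two : ∀ A : V → ℕ, Solvable G A (Pi.single c' 2) → ¬ A ≤ C := fun A hA hAC =>
    hns (solvable_mono (solvable_trans hA (solvable_single_of_adj hri.symm)) hAC le_rfl)
  have one := solvable_single_of_adj (hc y hyT)
  have hyc : y ≠ c' := (hc y hyT).ne
  have hi0 : C c' = 0 := by
    by_contra h
    refine two (Pi.single y 2 + Pi.single c' 1) ?_ fun v => ?_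
    · have := solvable_add one (solvable_of_le (G := G) (le_refl (Pi.single c' 1)))
      rwa [← Pi.single_add] at this
    · by_cases hv : v = c'
      · subst hv
        simp only [Pi.add_apply, Pi.single_eq_same, Pi.single_eq_of_ne hyc.symm]; omega
      · simpa [hv] using single_le hy v
  have hy3 : C y ≤ 3 := by
    by_contra h
    exact two _ (solvable_single_mul_of_adj (hc y hyT) 2) (single_le (by omega))
  have hz1 : ∀ z ∈ w :: T', z ≠ y → C z ≤ 1 := by
    intro z hz hzy
    by_contra h
    refine two (Pi.single y 2 + Pi.single z 2) ?_ fun v => ?_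
    · have := solvable_add one (solvable_single_of_adj (hc z hz))
      rwa [← Pi.single_add] at this
    · by_cases hv : v = z
      · subst hv
        simp only [Pi.add_apply, Pi.single_eq_same, Pi.single_eq_of_ne hzy]; omega
      · simpa [hv] using single_le hy v
  have h2 := hE (cut S C + Pi.single c' 1)
    (fun v hv => by
      simp only [List.mem_cons, not_or] at hv
      simp [cut_of_not_mem hv.2, hv.1])
    fun h => hns <| by
      refine solvable_mono (solvable_trans (solvable_add (solvable_of_le (le_refl (cut S C))) one)
        h) (fun v => ?_) le_rfl
      by_cases hv : v = y
      · subst hv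
        have : v ∉ S := fun h => hST v h hyT
        simp only [Pi.add_apply, Pi.single_eq_same, cut_of_not_mem this]; omega
      · simpa [hv] using cut_le S C v
  rw [sum_add_apply, sum_single] at h2
  have hz : ∀ z ∈ w :: T', z ≠ y → 1 ≤ C z := by
    intro z hz hzy
    by_contra h0
    have : ∑ v, (cut (w :: T') C v + (Pi.single z 1 : V → ℕ) v) ≤
        ∑ v, (cut (w :: T') (fun _ => 1) v + (Pi.single y 2 : V → ℕ) v) := by
      refine Finset.sum_le_sum fun v _ => ?_
      by_cases hvT : v ∈ w :: T'
      · rw [cut_of_mem hvT, cut_of_mem hvT]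
        by_cases hvz : v = z
        · subst hvz
          rw [Pi.single_eq_same, Pi.single_eq_of_ne hzy]; omega
        · rw [Pi.single_eq_of_ne hvz]
          by_cases hvy : v = y
          · subst hvy; rw [Pi.single_eq_same]; omega
          · have := hz1 v hvT hvy; omega
      · have : v ≠ z := fun h => hvT (h ▸ hz)
        rw [cut_of_not_mem hvT, Pi.single_eq_of_ne this]; omega
    rw [Finset.sum_add_distrib, Finset.sum_add_distrib, sum_single, sum_single,
      sum_cut_one hl] at this
    simp only [List.length_cons] at *
    omega
  obtain ⟨l₁, l₂, hl12⟩ := List.append_of_mem hyT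
  rw [hl12] at hp hl hz
  refine hns (solvable_mono (solvable_slide hp) (fun v => ?_) le_rfl)
  have hcount := List.nodup_iff_count_le_one.mp (List.nodup_append.mp hl).1 v
  by_cases hv : v = y
  · subst hv
    have : v ∉ l₁ := fun hv => (List.nodup_append.mp hl).2.2 v hv v (by simp) rfl
    simp only [Pi.add_apply, Pi.single_eq_same, List.count_eq_zero_of_not_mem this]
    omega
  · simp only [Pi.add_apply, Pi.single_eq_of_ne hv]
    by_cases hvl : v ∈ l₁
    · have := hz v (by simp [hvl]) hv; omega
    · rw [List.count_eq_zero_of_not_mem hvl]; omega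

theorem Side.cheap_or [Fintype V] [DecidableEq V] {j K : ℕ} {r i c x : V} {S : List V}
    (h : Side G j c x S) (hri : G.Adj r i) (hcx : c = r ∧ x = i ∨ c = i ∧ x = r)
    (hK : 2 * 2 ^ (j + 1) ≤ K) (C : V → ℕ) :
    Cheap G K r C ∨ ∑ v, cut S C v + (j + 2) ≤ S.length + 2 * 2 ^ (j + 1) ∧
      (S.length + 2 ^ (j + 1) < ∑ v, cut S C v + (j + 2) →
        ∃ C₀ ≤ cut S C, ∑ v, C₀ v ≤ 2 ^ (j + 1) ∧ Solvable G C₀ (Pi.single i 1)) := by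
  have h0 : ∀ v ∉ S, cut S C v = 0 := fun v hv => cut_of_not_mem hv C
  rcases hcx with ⟨rfl, -⟩ | ⟨rfl, -⟩
  · by_cases hN : S.length + 2 ^ (j + 1) < ∑ v, cut S C v + (j + 2)
    · obtain ⟨C₀, h1, h2, h3⟩ := h.exists_cheap _ h0 hN
      exact .inl ⟨C₀, h1.trans (cut_le S C), by omega, h3⟩
    · exact .inr ⟨by omega, fun h => absurd h hN⟩
  · by_cases hN : S.length + 2 ^ (j + 1) + 2 ^ (j + 1) < ∑ v, cut S C v + (j + 2)
    · obtain ⟨C₀, h1, h2, h3⟩ := exists_cheap_two (fun C hC hs => h.exists_cheap C hC hs) _ h0 hN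
      exact .inl ⟨C₀, h1.trans (cut_le S C), by omega,
        solvable_trans h3 (solvable_single_of_adj hri.symm)⟩
    · exact .inr ⟨by omega, fun hN => h.exists_cheap _ h0 hN⟩

theorem add_le_of_sides {jL jR d : ℕ} {r i cL xL cR xR : V} {S T : List V}
    (hL : Side G jL cL xL S) (hR : Side G jR cR xR T)
    (hn : (r :: i :: (S ++ T)).Nodup)
    (hcl : ∀ s ∈ S, ∀ y, G.Adj s y → y ∈ S ∨ y = r ∨ y = i)
    (hd : ∀ f : V → ℕ, (∀ p q, G.Adj p q → f p ≤ f q + 1) → ∀ p q, f p ≤ f q + d) :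
    jL + jR + 2 ≤ d := by
  classical
  obtain ⟨F, z, -, h1, h2, h3, -⟩ := hL.exists_level
  obtain ⟨F', z', -, h1', h2', h3', h4', -⟩ := hR.exists_level
  have hST : ∀ s ∈ S, s ∉ T := fun s h1 h2 =>
    (List.nodup_append.mp hn.of_cons.of_cons).2.2 s h1 s h2 rfl
  have hrT : r ∉ T := fun h => (List.nodup_cons.mp hn).1 (by simp [h])
  have hiT : i ∉ T := fun h => (List.nodup_cons.mp hn.of_cons).1 (by simp [h])
  have hzS : z ∈ S := by
    by_contra h
    have := (h1 z).2 h
    omega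
  have hzT : z' ∈ T := by
    by_contra h
    have := (h1' z').2 h
    omega
  have key := hd (fun v => F v + (jR + 1 - F' v)) (fun p q hpq => ?_) z z'
  · have e1 : F' z = 0 := (h1' z).2 (hST z hzS)
    have e2 : F z' = 0 := (h1 z').2 fun h => hST z' h hzT
    simp only [e1, e2, h3, h3'] at key
    omega
  · have b1 := h4' p
    have b2 := h4' q
    by_cases hp : p ∈ S
    · have e1 := h2 p hp q hpq
      have e2 : F' p = 0 := (h1' p).2 (hST p hp)
      have e3 : F' q = 0 := (h1' q).2 <| by
        rcases hcl p hp q hpq with h | rfl | rfl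
        · exact hST q h
        · exact hrT
        · exact hiT
      omega
    · have e1 : F p = 0 := (h1 p).2 hp
      by_cases hq : q ∈ T
      · have := h2' q hq p hpq.symm
        omega
      · have : F' q = 0 := (h1' q).2 hq
        omega

theorem rootBound_of_interior [Fintype V] [DecidableEq V] {jL jR d : ℕ}
    {r i cL xL cR xR : V} {S T : List V} (hri : G.Adj r i)
    (hL : Side G jL cL xL S) (hcx : cL = r ∧ xL = i ∨ cL = i ∧ xL = r)
    (hR : Side G jR cR xR T) (hcx' : cR = r ∧ xR = i ∨ cR = i ∧ xR = r)
    (hn : (r :: i :: (S ++ T)).Nodup) (hcov : ∀ v, v ∈ r :: i :: (S ++ T))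
    (hcl : ∀ s ∈ S, ∀ y, G.Adj s y → y ∈ S ∨ y = r ∨ y = i)
    (hcl' : ∀ s ∈ T, ∀ y, G.Adj s y → y ∈ T ∨ y = r ∨ y = i)
    (hd : ∀ f : V → ℕ, (∀ p q, G.Adj p q → f p ≤ f q + 1) → ∀ p q, f p ≤ f q + d) :
    RootBound G d r := by
  have hcard := card_eq_length hn hcov
  simp only [List.length_cons, List.length_append] at hcard
  have hdec : ∀ C : V → ℕ, C = Pi.single r (C r) + (Pi.single i (C i) + (cut S C + cut T C)) := by
    intro C
    rw [← cut_append hn.of_cons.of_cons, ← cut_cons hn.of_cons, ← cut_cons hn,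
      cut_eq_self fun v hv => absurd (hcov v) hv]
  have hsum : ∀ C : V → ℕ,
      ∑ v, C v = C r + (C i + (∑ v, cut S C v + ∑ v, cut T C v)) := by
    intro C
    conv_lhs => rw [hdec C]
    simp only [sum_add_apply, sum_single]
  have hle := add_le_of_sides hL hR hn hcl hd
  have hp := two_pow_add_le (by omega) hle
  have hpow : 2 ^ (jL + jR + 2) = 2 ^ (jL + 1) * 2 ^ (jR + 1) := by ring
  have hX : jL + 2 ≤ 2 ^ (jL + 1) := Nat.lt_two_pow_self
  have hY : jR + 2 ≤ 2 ^ (jR + 1) := Nat.lt_two_pow_self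
  have hmono : 2 ^ (jL + 1) * 2 ^ (jR + 1) ≤ 2 ^ d := hpow ▸ Nat.pow_le_pow_right (by norm_num) hle
  rw [hpow] at hp
  have hX2 : ∀ j, 1 ≤ j → j + 3 ≤ 2 ^ (j + 1) := by
    intro j hj
    induction j, hj using Nat.le_induction with
    | base => norm_num
    | succ j _ ih => rw [pow_succ]; omega
  have hXY : 2 ^ (jL + 1) + 2 ^ (jR + 1) ≤ 2 ^ (jL + 1) * 2 ^ (jR + 1) := by nlinarith
  have hXX : 2 * 2 ^ (jL + 1) ≤ 2 ^ (jL + 1) * 2 ^ (jR + 1) := by nlinarith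
  have hYY : 2 * 2 ^ (jR + 1) ≤ 2 ^ (jL + 1) * 2 ^ (jR + 1) := by nlinarith
  have key : ∀ C : V → ℕ, ¬ Cheap G (2 ^ d) r C →
      ∑ v, C v + (jL + jR + 4) ≤ S.length + T.length + 2 * 2 ^ (jL + 1) + 2 ^ (jR + 1) ∨
      ∑ v, C v + (jL + jR + 4) ≤ S.length + T.length + 2 ^ (jL + 1) + 2 * 2 ^ (jR + 1) := by
    intro C hC
    have hr0 : C r = 0 := by
      by_contra h
      exact hC (cheap_of_one_le Nat.one_le_two_pow (by omega))
    have hi1 : C i ≤ 1 := by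
      by_contra h
      exact hC (cheap_of_two_le (by omega) hri.symm (by omega))
    obtain ⟨l1, l2⟩ := (hL.cheap_or hri hcx (by omega) C).resolve_left hC
    obtain ⟨r1, r2⟩ := (hR.cheap_or hri hcx' (by omega) C).resolve_left hC
    have pair : ∀ A B : V → ℕ, A + B ≤ C → ∑ v, A v + ∑ v, B v ≤ 2 ^ d →
        Solvable G A (Pi.single i 1) → Solvable G B (Pi.single i 1) → False := by
      intro A B hAB hs hA hB
      refine hC ⟨A + B, hAB, by rwa [sum_add_apply], ?_⟩
      have := solvable_add hA hB
      rw [← Pi.single_add] at this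
      exact solvable_trans this (solvable_single_of_adj hri.symm)
    have hone := solvable_of_le (G := G) (le_refl (Pi.single i 1 : V → ℕ))
    have hle2 : Pi.single i (C i) + (cut S C + cut T C) ≤ C := by
      conv_rhs => rw [hdec C]
      exact le_add_self
    rw [hsum]
    by_cases hl : S.length + 2 ^ (jL + 1) < ∑ v, cut S C v + (jL + 2)
    · obtain ⟨A, hA1, hA2, hA3⟩ := l2 hl
      have hi0 : C i = 0 := by
        by_contra h
        refine pair _ A (le_trans (add_le_add (Pi.single_mono i (show 1 ≤ C i by omega))
          (hA1.trans le_self_add)) hle2) ?_ hone hA3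
        rw [sum_single]; omega
      by_cases hr : T.length + 2 ^ (jR + 1) < ∑ v, cut T C v + (jR + 2)
      · obtain ⟨B, hB1, hB2, hB3⟩ := r2 hr
        exact (pair A B ((add_le_add hA1 hB1).trans (le_add_self.trans hle2)) (by omega)
          hA3 hB3).elim
      · omega
    · by_cases hr : T.length + 2 ^ (jR + 1) < ∑ v, cut T C v + (jR + 2)
      · obtain ⟨B, hB1, hB2, hB3⟩ := r2 hr
        have hi0 : C i = 0 := by
          by_contra h
          refine pair _ B (le_trans (add_le_add (Pi.single_mono i (show 1 ≤ C i by omega))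
            (hB1.trans le_add_self)) hle2) ?_ hone hB3
          rw [sum_single]; omega
        omega
      · omega
  refine ⟨fun C hC => ?_, fun C hC => ?_⟩
  · rcases Nat.eq_zero_or_pos jR with rfl | hjR
    · exact solvable_of_thin hri hL hcx hR hcx' hn hcov hcl hd C hC
    rcases Nat.eq_zero_or_pos jL with rfl | hjL
    · have hperm : (r :: i :: (S ++ T)).Perm (r :: i :: (T ++ S)) :=
        (List.perm_append_comm.cons _).cons _
      exact solvable_of_thin hri hR hcx' hL hcx (hperm.nodup_iff.mp hn)
        (fun v => hperm.mem_iff.mp (hcov v)) hcl' hd C hC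
    by_contra hns
    have h1 := hX2 _ hjL
    have h2 := hX2 _ hjR
    rw [hcard] at hC
    rcases key C fun h => hns h.solvable with h | h <;> nlinarith
  · by_contra hns
    rw [hcard] at hC
    rcases key C hns with h | h <;> nlinarith

/-- A level function `F` towards `r` whose middle levels have few possible entry points `Z`. -/
def Levels (G : SimpleGraph V) (d : ℕ) (r : V) : Prop :=
  ∃ (F : V → ℕ) (z : V) (Z : Finset V), (∀ v, F v = 0 ↔ v = r) ∧
    (∀ p q, G.Adj p q → F p ≤ F q + 1) ∧ F z = d ∧ Z.card + 2 ≤ 2 * d ∧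
    r ∉ Z ∧ z ∉ Z ∧ ∀ p q, G.Adj p q → F p = F q + 1 → 1 ≤ F q → q ∈ Z

theorem Zip.exists_end {u u' a b : V} {S T : List V} (h : Zip G u u' a b S T) :
    ∃ j a b T, Side G j a b T ∧ G.Adj a u ∧ G.Adj b u ∧ G.Adj a b ∧ (u :: a :: b :: T).Nodup ∧
      (∀ v, v ∈ u :: a :: b :: T) ∧ ∀ x, G.Adj u x → x = a ∨ x = b := by
  have key : ∀ {j a b T}, Zip G u u' a b [u] T → Side G j a b T →
      ∃ j a b T, Side G j a b T ∧ G.Adj a u ∧ G.Adj b u ∧ G.Adj a b ∧ (u :: a :: b :: T).Nodup ∧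
      (∀ v, v ∈ u :: a :: b :: T) ∧ ∀ x, G.Adj u x → x = a ∨ x = b := by
    intro j a b T hz hs
    obtain ⟨ha, hb⟩ := hz.left.adj_of_singleton rfl
    obtain ⟨-, -, -, -, -, hu⟩ := hz.left.basic
    obtain ⟨-, hab, haT, hbT, hT, -⟩ := hz.right.basic
    have huT : u ∉ T := hz.disj u (by simp)
    refine ⟨j, a, b, T, hs, ha.symm, hb.symm, hab, ?_, fun v => ?_, fun x hx => ?_⟩
    · simp [ha.ne, hb.ne, hab.ne, haT, hbT, huT, hT]
    · have := hz.cover v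
      simp only [List.mem_cons, List.not_mem_nil, or_false] at this ⊢
      tauto
    · rcases hu u (by simp) x hx with h | h
      · exact absurd (List.mem_singleton.mp h) hx.ne'
      · exact h
  obtain ⟨a, b, T, hz⟩ := (h.left.unzip T h).1
  obtain ⟨j, hj | hj⟩ := hz.right.exists_side
  · exact key hz hj
  · exact key hz.swap hj

theorem Zip.ediam_and_levels {u u' a b : V} {S T : List V} (h : Zip G u u' a b S T) :
    G.ediam ≠ ⊤ ∧ Levels G G.diam u ∧
      ∀ [Fintype V] [DecidableEq V], RootBound G G.diam u := by
  classical
  obtain ⟨j, a, b, T, hs, hau, hbu, hab, hn, hcov, hu⟩ := h.exists_end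
  obtain ⟨⟨hua, hub, huT⟩, ⟨hab', haT⟩, hbT, hT⟩ :
      (u ≠ a ∧ u ≠ b ∧ u ∉ T) ∧ (a ≠ b ∧ a ∉ T) ∧ b ∉ T ∧ T.Nodup := by simpa using hn
  obtain ⟨e1, e2⟩ := hs.edist_le
  have far : ∀ v, v ∈ T ∨ G.edist v a ≤ (1 : ℕ) := by
    intro v
    have hv := hcov v
    simp only [List.mem_cons] at hv
    rcases hv with rfl | rfl | rfl | hv
    · exact .inr (edist_le_one_of_adj hau.symm)
    · exact .inr (by simp)
    · exact .inr (edist_le_one_of_adj hab.symm)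
    · exact .inl hv
  have near : ∀ v, G.edist v a ≤ (j + 1 : ℕ) := fun v =>
    (far v).elim (e1 v) fun h => edist_mono h (by omega)
  have hdle : G.ediam ≤ (j + 2 : ℕ) := by
    refine SimpleGraph.ediam_le_of_edist_le fun x y => ?_
    rcases far x with hx | hx
    · rcases far y with hy | hy
      · exact e2 x hx y hy
      · exact edist_le_add (near x) (SimpleGraph.edist_comm.trans_le hy) le_rfl
    · exact edist_le_add hx (SimpleGraph.edist_comm.trans_le (near y)) (by omega)
  have htop : G.ediam ≠ ⊤ := ne_top_of_le_ne_top (ENat.natCast_ne_top _) hdle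
  obtain ⟨F, z, Z, h1, h2, h3, -, h5, h6, h7, h8⟩ := hs.exists_level
  have hzT : z ∈ T := by
    by_contra h
    have := (h1 z).2 h
    omega
  have hzu : z ≠ u := fun h => huT (h ▸ hzT)
  have hFu := (h1 u).2 huT
  have hFa := (h1 a).2 haT
  have hFb := (h1 b).2 hbT
  have hlip : ∀ p q, G.Adj p q →
      (if p = u then 0 else F p + 1) ≤ (if q = u then 0 else F q + 1) + 1 := by
    intro p q hpq
    by_cases hp : p = u
    · simp [hp]
    by_cases hq : q = u
    · subst hq
      rcases hu p hpq.symm with rfl | rfl <;> simp [hp, hFa, hFb]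
    · simp only [hp, hq, if_false]
      by_cases hpT : p ∈ T
      · have := h2 p hpT q hpq
        omega
      · have := (h1 p).2 hpT
        omega
  have hdiam : G.diam = j + 2 := by
    refine le_antisymm (ENat.toNat_le_of_le_natCast hdle) ?_
    have := le_add_diam htop hlip z u
    simp only [hzu, if_false, if_true, h3] at this
    omega
  refine ⟨htop, ?_, fun {_ _} => ?_⟩
  · rw [hdiam]
    refine ⟨fun v => if v = u then 0 else F v + 1, z, insert a (insert b Z), fun v => by simp,
      hlip, by simp [hzu, h3], ?_, ?_, ?_, fun p q hpq hF hq1 => ?_⟩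
    · have := Finset.card_insert_le a (insert b Z)
      have := Finset.card_insert_le b Z
      omega
    · have : u ∉ Z := fun h => huT (h6 u h)
      simp [hua, hub, this]
    · have hza : z ≠ a := fun h => haT (h ▸ hzT)
      have hzb : z ≠ b := fun h => hbT (h ▸ hzT)
      simp [hza, hzb, h7]
    · have hq : q ≠ u := by
        rintro rfl
        simp at hq1
      have hp : p ≠ u := by
        rintro rfl
        simp at hF
      simp only [hp, hq, if_false] at hF
      rw [Finset.mem_insert, Finset.mem_insert]
      rcases Nat.eq_zero_or_pos (F q) with h0 | h0
      · have hqT := (h1 q).1 h0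
        have := hcov q
        simp only [List.mem_cons] at this
        tauto
      · exact .inr (.inr (h8 p q hpq (by omega) h0))
  · exact rootBound_of_end hs hau hbu (by convert hn) (by convert hcov) hdiam.ge

theorem rootBound_and_levels [Fintype V] [DecidableEq V] (hG : IsTwoPath G) :
    (∀ r, RootBound G G.diam r) ∧ ∃ r, Levels G G.diam r := by
  have complete : ∀ p q : V, p ≠ q → (∀ x y, x ≠ y → G.Adj x y) →
      (∀ r, RootBound G G.diam r) ∧ ∃ r, Levels G G.diam r := by
    intro p q hpq hadj
    have : Nontrivial V := ⟨p, q, hpq⟩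
    have hd : G.diam = 1 := SimpleGraph.diam_eq_one.mpr <| by
      ext x y
      exact ⟨fun h => h.ne, fun h => hadj x y h⟩
    rw [hd]
    refine ⟨fun r => rootBound_of_forall_adj fun v hv => hadj v r hv, p,
      fun v => if v = p then 0 else 1, q, ∅, by simp, ?_, by simp [hpq.symm], by simp, by simp,
      by simp, ?_⟩
    · intro x y _
      dsimp only
      split_ifs <;> omega
    · intro x y _ h1 h2
      dsimp only at h1 h2
      split_ifs at h1 h2 <;> omega
  rcases exists_zip hG with ⟨p, q, hpq, hcov⟩ | ⟨p, q, r, hpq, hpr, hqr, hcov⟩ |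
    ⟨u, u', a, b, S, T, hz⟩
  · refine complete p q hpq.ne fun x y hxy => ?_
    rcases hcov x with rfl | rfl <;> rcases hcov y with rfl | rfl <;>
      first | exact absurd rfl hxy | assumption | exact hpq.symm
  · refine complete p q hpq.ne fun x y hxy => ?_
    rcases hcov x with rfl | rfl | rfl <;> rcases hcov y with rfl | rfl | rfl <;>
      first | exact absurd rfl hxy | assumption | (apply SimpleGraph.Adj.symm; assumption)
  · obtain ⟨htop, hlev, hroot⟩ := hz.ediam_and_levels
    refine ⟨fun r => ?_, u, hlev⟩
    rcases hz.cases_root r with rfl | rfl | ⟨a, b, S, T, hz, rfl⟩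
    · exact hroot
    · exact hz.symm.ediam_and_levels.2.2
    · obtain ⟨-, hab, haS, hbS, hS, hcl⟩ := hz.left.basic
      obtain ⟨-, -, haT, hbT, hT, hcl'⟩ := hz.right.basic
      have hn : (r :: b :: (S ++ T)).Nodup := by
        simp only [List.nodup_cons, List.mem_cons, List.mem_append, List.nodup_append]
        exact ⟨by simp [hab.ne, haS, haT], by simp [hbS, hbT], hS, hT,
          fun x hx y hy hxy => hz.disj x hx (hxy ▸ hy)⟩
      have hcov : ∀ v, v ∈ r :: b :: (S ++ T) := fun v => by simpa using hz.cover v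
      obtain ⟨jL, hL⟩ := hz.left.exists_side
      obtain ⟨jR, hR⟩ := hz.right.exists_side
      have hd := fun f hf => le_add_diam (G := G) htop (f := f) hf
      rcases hL with hL | hL <;> rcases hR with hR | hR <;>
        exact rootBound_of_interior hab hL (by tauto) hR (by tauto) hn hcov hcl hcl' hd

theorem solvable_of_rootBound [Fintype V] [DecidableEq V] {d : ℕ} (h : ∀ r, RootBound G d r)
    {t : ℕ} (ht : 1 ≤ t) {D : V → ℕ} (hD : ∑ v, D v = t) {C : V → ℕ}
    (hC : t * 2 ^ d + Fintype.card V ≤ ∑ v, C v + 2 * d) : Solvable G C D := by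
  induction t, ht using Nat.le_induction generalizing C D with
  | base =>
    obtain ⟨r, -, hr⟩ : ∃ r ∈ Finset.univ, D r ≠ 0 :=
      Finset.exists_ne_zero_of_sum_ne_zero (by omega)
    have hle : (Pi.single r 1 : V → ℕ) ≤ D := single_le (by omega)
    have hsum := sum_sub_add hle
    rw [sum_single, hD] at hsum
    have h0 : ∑ v, (D - Pi.single r 1 : V → ℕ) v = 0 := by omega
    refine solvable_mono ((h r).solvable C (by omega)) le_rfl fun v => ?_
    exact Nat.sub_eq_zero_iff_le.mp ((Finset.sum_eq_zero_iff.mp h0) v (Finset.mem_univ v))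
  | succ t ht ih =>
    obtain ⟨r, -, hr⟩ : ∃ r ∈ Finset.univ, D r ≠ 0 :=
      Finset.exists_ne_zero_of_sum_ne_zero (by omega)
    have hle : (Pi.single r 1 : V → ℕ) ≤ D := single_le (by omega)
    have hsum := sum_sub_add hle
    rw [sum_single, hD] at hsum
    have htd : (t + 1) * 2 ^ d = t * 2 ^ d + 2 ^ d := by ring
    have hd : 2 ^ d ≤ t * 2 ^ d := Nat.le_mul_of_pos_left _ ht
    obtain ⟨C₀, h1, h2, h3⟩ := (h r).cheap C (by omega)
    have hsum' := sum_sub_add h1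
    have := solvable_add (ih (D := D - Pi.single r 1) (C := C - C₀) (by omega) (by omega)) h3
    rwa [tsub_add_cancel_of_le h1, tsub_add_cancel_of_le hle] at this

theorem exists_le_sum_eq [Fintype V] {C : V → ℕ} {m : ℕ} (h : m ≤ ∑ v, C v) :
    ∃ C' ≤ C, ∑ v, C' v = m := by
  classical
  induction m with
  | zero => exact ⟨0, zero_le, by simp⟩
  | succ m ih =>
    obtain ⟨C', h1, h2⟩ := ih (by omega)
    obtain ⟨v, -, hv⟩ := Finset.exists_lt_of_sum_lt (s := Finset.univ) (f := C') (g := C)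
      (by omega)
    refine ⟨C' + Pi.single v 1, fun y => ?_, by rw [sum_add_apply, sum_single, h2]⟩
    by_cases hy : y = v
    · subst hy
      simpa using hv
    · simpa [hy] using h1 y

theorem weight_le_of_pebblingStep [Fintype V] [DecidableEq V] {d : ℕ} {r : V} {F : V → ℕ}
    {Z : Finset V} (h0 : ∀ v, F v = 0 ↔ v = r) (h1 : ∀ p q, G.Adj p q → F p ≤ F q + 1)
    (h2 : ∀ p q, G.Adj p q → F p = F q + 1 → 1 ≤ F q → q ∈ Z)
    {C C' : V → ℕ} (h : PebblingStep G C C') :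
    ∑ v, (if v = r ∨ v ∈ Z then C' v else 2 * (C' v / 2)) * 2 ^ (d - F v) ≤
      ∑ v, (if v = r ∨ v ∈ Z then C v else 2 * (C v / 2)) * 2 ^ (d - F v) := by
  obtain ⟨p, q, hpq, hp2, rfl⟩ := h
  have hle : ∀ v, (if v = r ∨ v ∈ Z then (if v = p then C p - 2 else if v = q then C q + 1 else C v)
        else 2 * ((if v = p then C p - 2 else if v = q then C q + 1 else C v) / 2)) * 2 ^ (d - F v) +
        (Pi.single p (2 * 2 ^ (d - F p)) : V → ℕ) v ≤
      (if v = r ∨ v ∈ Z then C v else 2 * (C v / 2)) * 2 ^ (d - F v) +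
        (Pi.single q (2 * 2 ^ (d - F p)) : V → ℕ) v := by
    intro v
    by_cases hvp : v = p
    · subst hvp
      rw [Pi.single_eq_same, Pi.single_eq_of_ne hpq.ne, add_zero, ← add_mul]
      refine Nat.mul_le_mul_right _ ?_
      simp only [if_true]
      split_ifs <;> omega
    · rw [Pi.single_eq_of_ne hvp]
      by_cases hvq : v = q
      · subst hvq
        rw [Pi.single_eq_same]
        simp only [hvp, if_false, if_true, add_zero]
        by_cases hv : v = r ∨ v ∈ Z
        · simp only [hv, if_true]
          have : 2 ^ (d - F v) ≤ 2 * 2 ^ (d - F p) := by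
            rw [← pow_succ']
            have := h1 p v hpq
            exact Nat.pow_le_pow_right (by norm_num) (by omega)
          linarith [add_mul (C v) 1 (2 ^ (d - F v))]
        · simp only [hv, if_false]
          push Not at hv
          have hF := h1 p v hpq
          have hF0 : F v ≠ 0 := fun h => hv.1 ((h0 v).1 h)
          have : F p ≠ F v + 1 := fun h => hv.2 (h2 p v hpq h (by omega))
          have hpow : 2 ^ (d - F v) ≤ 2 ^ (d - F p) :=
            Nat.pow_le_pow_right (by norm_num) (by omega)
          have hdiv : 2 * ((C v + 1) / 2) ≤ 2 * (C v / 2) + 2 := by omega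
          calc _ ≤ (2 * (C v / 2) + 2) * 2 ^ (d - F v) := Nat.mul_le_mul_right _ hdiv
            _ ≤ _ := by linarith [add_mul (2 * (C v / 2)) 2 (2 ^ (d - F v))]
      · simp [hvp, hvq]
  have hsum := Finset.sum_le_sum fun v (_ : v ∈ Finset.univ) => hle v
  rw [Finset.sum_add_distrib, Finset.sum_add_distrib, sum_single, sum_single] at hsum
  exact Nat.le_of_add_le_add_right hsum

theorem Levels.exists_not_solvable [Fintype V] [DecidableEq V] {d t m : ℕ} {r : V}
    (h : Levels G d r) (ht : 1 ≤ t) (hm : m + 2 * d < t * 2 ^ d + Fintype.card V) :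
    ∃ C : V → ℕ, ∑ v, C v = m ∧ ¬ Solvable G C (stack r t) := by
  obtain ⟨F, z, Z, h0, h1, hz, hZ, hrZ, hzZ, h3⟩ := h
  have hzr : z ≠ r := by
    rintro rfl
    have := (h0 z).2 rfl
    omega
  obtain ⟨e, he⟩ : ∃ e, t * 2 ^ d = 2 * e + 2 := by
    obtain ⟨d', rfl⟩ : ∃ d', d = d' + 1 := ⟨d - 1, by omega⟩
    have : 1 ≤ t * 2 ^ d' := Nat.mul_pos ht (by positivity)
    exact ⟨t * 2 ^ d' - 1, by rw [pow_succ, ← mul_assoc]; omega⟩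
  set C₁ : V → ℕ := fun v => if v = z then 2 * e + 1 else if v = r ∨ v ∈ Z then 0 else 1 with hC₁
  have hsum : ∑ v, C₁ v + (1 + Z.card) = Fintype.card V + 2 * e := by
    have : ∑ v, (C₁ v + ((Pi.single r 1 : V → ℕ) v + if v ∈ Z then 1 else 0)) =
        ∑ v, (1 + (Pi.single z (2 * e) : V → ℕ) v) := by
      refine Finset.sum_congr rfl fun v _ => ?_
      by_cases hvz : v = z
      · subst hvz
        simp [hC₁, hzr, hzZ]; omega
      · by_cases hvr : v = r
        · subst hvr
          simp [hC₁, hvz, hrZ]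
        · by_cases hvZ : v ∈ Z <;> simp [hC₁, hvz, hvr, hvZ]
    rw [Finset.sum_add_distrib, Finset.sum_add_distrib, Finset.sum_add_distrib, sum_single,
      sum_single] at this
    simpa using this
  obtain ⟨C, hC, hCm⟩ := exists_le_sum_eq (C := C₁) (m := m) (by omega)
  refine ⟨C, hCm, fun hs => ?_⟩
  obtain ⟨C', hsteps, hC'⟩ := solvable_mono hs hC le_rfl
  have hmono : ∑ v, (if v = r ∨ v ∈ Z then C' v else 2 * (C' v / 2)) * 2 ^ (d - F v) ≤
      ∑ v, (if v = r ∨ v ∈ Z then C₁ v else 2 * (C₁ v / 2)) * 2 ^ (d - F v) := by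
    clear hC'
    induction hsteps with
    | refl => exact le_rfl
    | tail _ h ih => exact (weight_le_of_pebblingStep h0 h1 h3 h).trans ih
  have hup : ∑ v, (if v = r ∨ v ∈ Z then C₁ v else 2 * (C₁ v / 2)) * 2 ^ (d - F v) ≤
      ∑ v, (Pi.single z (2 * e) : V → ℕ) v := by
    refine Finset.sum_le_sum fun v _ => ?_
    by_cases hvz : v = z
    · subst hvz
      have : (2 * e + 1) / 2 = e := by omega
      simp [hC₁, hzr, hzZ, hz, this]
    · by_cases hv : v = r ∨ v ∈ Z <;> simp [hC₁, hvz, hv]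
  have hlow := Finset.single_le_sum
    (f := fun v => (if v = r ∨ v ∈ Z then C' v else 2 * (C' v / 2)) * 2 ^ (d - F v))
    (fun v _ => Nat.zero_le _) (Finset.mem_univ r)
  have hr : t ≤ C' r := by simpa [stack] using hC' r
  simp only [true_or, if_true, (h0 r).2 rfl, Nat.sub_zero] at hlow
  have := Nat.mul_le_mul_right (2 ^ d) hr
  rw [sum_single] at hup
  omega

end Pebbling

theorem twopath_target {V : Type} [Fintype V] [DecidableEq V]
    (G : SimpleGraph V) (hG : IsTwoPath G) (d n : ℕ)
    (hd : G.diam = d) (hn : Fintype.card V = n)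
    (D : V → ℕ) (t : ℕ) (ht : 1 ≤ t) (hD : ∑ v, D v = t) :
    pebblingNumber G D ≤ tPebblingNumber G t ∧
    tPebblingNumber G t = t * 2 ^ d + n - 2 * d ∧
    ∀ C : V → ℕ, (∑ v, C v) = t * 2 ^ d + n - 2 * d → Solvable G C D := by
  subst hd hn
  obtain ⟨hroot, r, hlev⟩ := Pebbling.rootBound_and_levels hG
  have hsolv : ∀ D : V → ℕ, ∑ v, D v = t → ∀ C : V → ℕ,
      (∑ v, C v) = t * 2 ^ G.diam + Fintype.card V - 2 * G.diam → Solvable G C D :=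
    fun D hD C hC => Pebbling.solvable_of_rootBound hroot ht hD (by omega)
  have hstack : ∀ r : V, ∑ v, stack r t v = t := fun r => by simp [stack]
  have heq : tPebblingNumber G t = t * 2 ^ G.diam + Fintype.card V - 2 * G.diam := by
    refine le_antisymm (Finset.sup_le fun r _ => Nat.sInf_le (hsolv _ (hstack r)))
      (le_trans ?_ (Finset.le_sup (Finset.mem_univ r)))
    have hmem : pebblingNumber G (stack r t) ∈
        {m | ∀ C : V → ℕ, (∑ v, C v) = m → Solvable G C (stack r t)} :=
      Nat.sInf_mem ⟨_, hsolv _ (hstack r)⟩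
    by_contra hlt
    obtain ⟨C, hC, hns⟩ := hlev.exists_not_solvable (m := pebblingNumber G (stack r t)) ht
      (by omega)
    exact hns (hmem C hC)
  exact ⟨heq ▸ Nat.sInf_le (hsolv D hD), heq, hsolv D hD⟩
end

section
/- Let r be a vertex of the Petersen graph G = K(5, 2). If C is a configuration on G of size 9 that is not r-solvable, then C = J_r, the configuration with zero pebbles on r and exactly one pebble on every other vertex. -/
/-- No sequence of pebbling steps puts a pebble on `r`. -/
def Unreachable {V : Type} [DecidableEq V] (G : SimpleGraph V) (r : V) (C : V → ℕ) : Prop :=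
  ¬ Solvable G C (stack r 1)

namespace Unreachable

variable {V : Type} [DecidableEq V] {G : SimpleGraph V} {r u v w w' z : V} {C : V → ℕ}

theorem root_eq_zero (h : Unreachable G r C) : C r = 0 := by
  by_contra hr
  refine h ⟨C, .refl, fun v => ?_⟩
  unfold stack
  split_ifs with hv
  · subst hv
    omega
  · omega

theorem step (h : Unreachable G r C) (huv : G.Adj u v) (hu : 2 ≤ C u) :
    Unreachable G r (fun w => if w = u then C u - 2 else if w = v then C v + 1 else C w) :=
  fun ⟨C', hC', hr⟩ => h ⟨C', .head ⟨u, v, huv, hu, rfl⟩ hC', hr⟩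

theorem le_one (h : Unreachable G r C) (hu : G.Adj u r) : C u ≤ 1 := by
  by_contra! hC
  have := (h.step hu hC).root_eq_zero
  simp [hu.ne'] at this

theorem le_one_of_one_le (h : Unreachable G r C) (hu : G.Adj u r) (hw : G.Adj w u)
    (hC : 1 ≤ C u) : C w ≤ 1 := by
  by_contra! hCw
  have := (h.step hw hCw).le_one hu
  simp only [hw.ne', if_false, if_true] at this
  omega

theorem le_three (h : Unreachable G r C) (hu : G.Adj u r) (hw : G.Adj w u) : C w ≤ 3 := by
  by_contra! hCw
  have := (h.step hw (by omega)).le_one_of_one_le hu hw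
  simp only [hw.ne', if_false, if_true] at this
  omega

theorem le_one_of_two_le (h : Unreachable G r C) (hu : G.Adj u r) (hw : G.Adj w u)
    (hw' : G.Adj w' u) (hne : w' ≠ w) (hC : 2 ≤ C w) : C w' ≤ 1 := by
  have := (h.step hw hC).le_one_of_one_le hu hw'
  simp only [hw.ne', hw'.ne, hne, if_false, if_true] at this
  omega

theorem le_one_of_path (h : Unreachable G r C) (hu : G.Adj u r) (hw : G.Adj w u)
    (hv : G.Adj v w) (hne : u ≠ v) (hCu : 1 ≤ C u) (hCw : 1 ≤ C w) : C v ≤ 1 := by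
  by_contra! hCv
  have := (h.step hv hCv).le_one_of_one_le hu hw
  simp only [hv.ne', hw.ne', hne, if_false, if_true] at this
  omega

theorem le_two_of_adj (h : Unreachable G r C) (hu : G.Adj u r) (hw : G.Adj w u)
    (hv : G.Adj v w) (hCv : 2 ≤ C v) : C w ≤ 2 := by
  have := (h.step hv hCv).le_three hu hw
  simp only [hv.ne', if_false, if_true] at this
  omega

theorem le_one_of_sibling (h : Unreachable G r C) (hu : G.Adj u r) (hw : G.Adj w u)
    (hw' : G.Adj w' u) (hne : w' ≠ w) (hv : G.Adj v w) (hvw' : w' ≠ v)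
    (hCv : 2 ≤ C v) (hCw : 1 ≤ C w) : C w' ≤ 1 := by
  have := (h.step hv hCv).le_one_of_two_le hu hw hw' hne
  simp only [hv.ne', hvw', hne, if_false, if_true] at this
  omega

theorem le_one_of_sibling_of_two (h : Unreachable G r C) (hu : G.Adj u r) (hw : G.Adj w u)
    (hw' : G.Adj w' u) (hne : w' ≠ w) (hv : G.Adj v w) (hvw' : w' ≠ v) (hz : G.Adj z w)
    (hzw' : w' ≠ z) (hvz : z ≠ v) (hCv : 2 ≤ C v) (hCz : 2 ≤ C z) : C w' ≤ 1 := by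
  have := (h.step hv hCv).le_one_of_sibling hu hw hw' hne hz hzw'
  simp only [hv.ne', hz.ne, hvw', hvz, hne, if_false, if_true] at this
  omega

end Unreachable

/-- The arithmetic of a hexagon `y` whose antipodal vertices `i`, `i + 3` share an apex `x i`. -/
theorem hexagon_eq_one (x y : Fin 6 → ℕ) (hx : ∀ i, x (i + 3) = x i)
    (hsum : x 0 + x 1 + x 2 + (y 0 + y 1 + y 2 + y 3 + y 4 + y 5) = 9)
    (hx1 : ∀ i, x i ≤ 1) (hxy : ∀ i, 1 ≤ x i → y i ≤ 1) (hy : ∀ i, y i ≤ 3)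
    (hyy : ∀ i, 2 ≤ y i → y (i + 3) ≤ 1)
    (hpath : ∀ i, 1 ≤ x i → 1 ≤ y i → y (i + 1) ≤ 1 ∧ y (i + 5) ≤ 1)
    (hadj : ∀ i, 2 ≤ y (i + 1) ∨ 2 ≤ y (i + 5) → y i ≤ 2)
    (hsib : ∀ i, 2 ≤ y (i + 1) ∨ 2 ≤ y (i + 5) → 1 ≤ y i → y (i + 3) ≤ 1)
    (htri : ∀ i, 2 ≤ y (i + 1) → 2 ≤ y (i + 5) → y (i + 3) ≤ 1) (i : Fin 6) :
    x i = 1 ∧ y i = 1 := by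
  simp only [Fin.forall_fin_succ, Fin.isValue, Fin.succ_zero_eq_one, Fin.succ_one_eq_two,
    Fin.reduceSucc, Fin.reduceAdd, IsEmpty.forall_iff, and_true, zero_add]
    at hx hx1 hxy hy hyy hpath hadj hsib htri
  have hy1 : y 0 ≤ 1 ∧ y 1 ≤ 1 ∧ y 2 ≤ 1 ∧ y 3 ≤ 1 ∧ y 4 ≤ 1 ∧ y 5 ≤ 1 := by
    refine ⟨?_, ?_, ?_, ?_, ?_, ?_⟩ <;> grind
  clear hxy hy hyy hpath hadj hsib htri
  fin_cases i <;> simp only [Fin.zero_eta, Fin.mk_one, Fin.reduceFinMk] <;> omega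

/-- The automorphism of the Kneser graph induced by a permutation of the ground set. -/
def kneserRelabel {m h : ℕ} (σ : Equiv.Perm (Fin m)) : kneserGraph m h ≃g kneserGraph m h where
  toEquiv := σ.finsetCongr.subtypeEquiv fun s => by simp
  map_rel_iff' {a b} := by
    simp [kneserGraph, SimpleGraph.fromRel_adj, Subtype.ext_iff]

/-- The vertex `{0, 1}` of the Petersen graph. -/
def petersenRoot : {s : Finset (Fin 5) // s.card = 2} :=
  ⟨{0, 1}, rfl⟩

theorem exists_iso_petersenRoot_eq (r : {s : Finset (Fin 5) // s.card = 2}) :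
    ∃ φ : kneserGraph 5 2 ≃g kneserGraph 5 2, φ petersenRoot = r := by
  obtain ⟨s, hs⟩ := r
  obtain ⟨i, j, hij, rfl⟩ := Finset.card_eq_two.mp hs
  have hσ : ∀ i j : Fin 5, i ≠ j →
      (Equiv.swap (Equiv.swap 0 i 1) j * Equiv.swap 0 i) 0 = i ∧
        (Equiv.swap (Equiv.swap 0 i 1) j * Equiv.swap 0 i) 1 = j := by
    decide
  obtain ⟨h0, h1⟩ := hσ i j hij
  generalize Equiv.swap (Equiv.swap 0 i 1) j * Equiv.swap 0 i = σ at h0 h1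
  refine ⟨kneserRelabel σ, Subtype.ext ?_⟩
  simp [kneserRelabel, petersenRoot, h0, h1]

/-- The neighbours of `{0, 1}` in the Petersen graph, listed with period three. -/
def petersenApex : Fin 6 → {s : Finset (Fin 5) // s.card = 2} :=
  ![⟨{3, 4}, rfl⟩, ⟨{2, 4}, rfl⟩, ⟨{2, 3}, rfl⟩, ⟨{3, 4}, rfl⟩, ⟨{2, 4}, rfl⟩, ⟨{2, 3}, rfl⟩]

/-- The hexagon formed by the vertices at distance two from `{0, 1}` in the Petersen graph. -/
def petersenHexagon : Fin 6 → {s : Finset (Fin 5) // s.card = 2} :=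
  ![⟨{0, 2}, rfl⟩, ⟨{1, 3}, rfl⟩, ⟨{0, 4}, rfl⟩, ⟨{1, 2}, rfl⟩, ⟨{0, 3}, rfl⟩, ⟨{1, 4}, rfl⟩]

theorem petersenApex_add_three (i : Fin 6) : petersenApex (i + 3) = petersenApex i := by
  decide +revert

instance (m h : ℕ) : DecidableRel (kneserGraph m h).Adj :=
  inferInstanceAs (DecidableRel (SimpleGraph.fromRel _).Adj)

theorem petersenApex_adj_root (i : Fin 6) :
    (kneserGraph 5 2).Adj (petersenApex i) petersenRoot := by
  decide +revert

theorem petersenHexagon_adj_apex (i : Fin 6) :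
    (kneserGraph 5 2).Adj (petersenHexagon i) (petersenApex i) := by
  decide +revert

theorem petersenHexagon_adj_succ (i : Fin 6) :
    (kneserGraph 5 2).Adj (petersenHexagon i) (petersenHexagon (i + 1)) := by
  decide +revert

theorem petersenHexagon_injective : Function.Injective petersenHexagon := by
  decide

theorem petersenApex_ne_hexagon (i j : Fin 6) : petersenApex i ≠ petersenHexagon j := by
  decide +revert

theorem petersenHexagon_ne_root (i : Fin 6) : petersenHexagon i ≠ petersenRoot := by
  decide +revert

theorem petersen_univ : (Finset.univ : Finset {s : Finset (Fin 5) // s.card = 2}) =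
    {petersenRoot, petersenApex 0, petersenApex 1, petersenApex 2, petersenHexagon 0,
      petersenHexagon 1, petersenHexagon 2, petersenHexagon 3, petersenHexagon 4,
      petersenHexagon 5} := by
  decide

theorem petersen_sum (f : {s : Finset (Fin 5) // s.card = 2} → ℕ) :
    ∑ v, f v = f petersenRoot + (f (petersenApex 0) + f (petersenApex 1) + f (petersenApex 2) +
      (f (petersenHexagon 0) + f (petersenHexagon 1) + f (petersenHexagon 2) +
        f (petersenHexagon 3) + f (petersenHexagon 4) + f (petersenHexagon 5))) := by
  rw [petersen_univ]
  repeat rw [Finset.sum_insert (by decide)]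
  rw [Finset.sum_singleton]
  ring

theorem petersen_cases (v : {s : Finset (Fin 5) // s.card = 2}) :
    v = petersenRoot ∨ ∃ i, v = petersenApex i ∨ v = petersenHexagon i := by
  decide +revert

theorem petersen_unsolvable_size_nine (r : {s : Finset (Fin 5) // s.card = 2})
    (C : {s : Finset (Fin 5) // s.card = 2} → ℕ)
    (hsize : (∑ v, C v) = 9)
    (hunsolv : ¬ Solvable (kneserGraph 5 2) C (stack r 1)) :
    C = fun v => if v = r then 0 else 1 := by
  obtain ⟨φ, rfl⟩ := exists_iso_petersenRoot_eq r
  have hC : Unreachable (kneserGraph 5 2) (φ petersenRoot) C := hunsolv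
  have adj {u v} (h : (kneserGraph 5 2).Adj u v) : (kneserGraph 5 2).Adj (φ u) (φ v) :=
    φ.map_adj_iff.mpr h
  have har i := adj (petersenApex_adj_root i)
  have hha i := adj (petersenHexagon_adj_apex i)
  have hha' (i : Fin 6) :
      (kneserGraph 5 2).Adj (φ (petersenHexagon (i + 3))) (φ (petersenApex i)) := by
    simpa only [petersenApex_add_three] using hha (i + 3)
  have hsucc i := (adj (petersenHexagon_adj_succ i)).symm
  have hpred (i : Fin 6) :
      (kneserGraph 5 2).Adj (φ (petersenHexagon (i + 5))) (φ (petersenHexagon i)) := by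
    simpa only [add_assoc, Fin.reduceAdd, add_zero] using adj (petersenHexagon_adj_succ (i + 5))
  have hne {i j : Fin 6} (hij : i ≠ j) : φ (petersenHexagon i) ≠ φ (petersenHexagon j) :=
    φ.injective.ne (petersenHexagon_injective.ne hij)
  have hane i j : φ (petersenApex i) ≠ φ (petersenHexagon j) :=
    φ.injective.ne (petersenApex_ne_hexagon i j)
  have hroot := hC.root_eq_zero
  have hone := hexagon_eq_one (fun i => C (φ (petersenApex i)))
    (fun i => C (φ (petersenHexagon i))) (fun i => by simp only [petersenApex_add_three])
    (by
      have := φ.toEquiv.sum_comp C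
      rw [hsize, petersen_sum] at this
      simpa [hroot] using this)
    (fun i => hC.le_one (har i))
    (fun i => hC.le_one_of_one_le (har i) (hha i))
    (fun i => hC.le_three (har i) (hha i))
    (fun i => hC.le_one_of_two_le (har i) (hha i) (hha' i) (hne (by simp)))
    (fun i hx hy => ⟨hC.le_one_of_path (har i) (hha i) (hsucc i) (hane _ _) hx hy,
      hC.le_one_of_path (har i) (hha i) (hpred i) (hane _ _) hx hy⟩)
    (fun i h => h.elim (hC.le_two_of_adj (har i) (hha i) (hsucc i))
      (hC.le_two_of_adj (har i) (hha i) (hpred i)))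
    (fun i h => h.elim
      (hC.le_one_of_sibling (har i) (hha i) (hha' i) (hne (by simp)) (hsucc i) (hne (by simp)))
      (hC.le_one_of_sibling (har i) (hha i) (hha' i) (hne (by simp)) (hpred i) (hne (by simp))))
    (fun i => hC.le_one_of_sibling_of_two (har i) (hha i) (hha' i) (hne (by simp)) (hsucc i)
      (hne (by simp)) (hpred i) (hne (by simp)) (hne (by simp)))
  funext w
  obtain ⟨v, rfl⟩ := φ.surjective w
  obtain rfl | ⟨i, rfl | rfl⟩ := petersen_cases v
  · simpa using hroot
  · rw [if_neg (har i).ne, (hone i).1]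
  · rw [if_neg (φ.injective.ne (petersenHexagon_ne_root i)), (hone i).2]
end

section
/- Let G = K(m, 2) for some m > 5 and let D be any target distribution on G of size t ≥ 1. Then π(G, D) ≤ p(m, t), where p(m, t) = max( C(m,2) + 2t − 2, 4t + 2m − 5 ); that is, every configuration on G of size p(m, t) is D-solvable. -/
section PairCount

variable {V : Type} [Fintype V]

/-- The number of disjoint pairs of pebbles lying on common vertices. -/
def pairCount (C : V → ℕ) : ℕ := ∑ v, C v / 2

lemma exists_two_le {C : V → ℕ} (h : 1 ≤ pairCount C) : ∃ v, 2 ≤ C v := by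
  obtain ⟨v, -, hv⟩ := Finset.exists_ne_zero_of_sum_ne_zero (Nat.one_le_iff_ne_zero.mp h)
  exact ⟨v, by omega⟩

lemma sum_add_card_even (C : V → ℕ) :
    ∑ v, C v + (Finset.univ.filter fun v => Even (C v)).card
      = 2 * pairCount C + Fintype.card V := by
  rw [pairCount, Finset.mul_sum, Finset.card_filter, Fintype.card_eq_sum_ones,
    ← Finset.sum_add_distrib, ← Finset.sum_add_distrib]
  refine Finset.sum_congr rfl fun v _ => ?_
  split_ifs with h
  · have := Nat.even_iff.mp h; omega
  · have := Nat.not_even_iff.mp h; omega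

end PairCount

section Pebbling

variable {V : Type} [DecidableEq V] {G : SimpleGraph V}

lemma pebblingStep_add {C C' : V → ℕ} (E : V → ℕ) (h : PebblingStep G C C') :
    PebblingStep G (C + E) (C' + E) := by
  obtain ⟨u, v, huv, hu, rfl⟩ := h
  refine ⟨u, v, huv, by simp only [Pi.add_apply]; omega, ?_⟩
  funext w
  simp only [Pi.add_apply]
  split_ifs with h1 h2
  · subst h1; omega
  · subst h2; omega
  · rfl

lemma Solvable.add {C D : V → ℕ} (E : V → ℕ) (h : Solvable G C D) :
    Solvable G (C + E) (D + E) := by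
  obtain ⟨C', hC, hD⟩ := h
  exact ⟨C' + E, hC.lift (· + E) fun _ _ hs => pebblingStep_add E hs,
    fun v => Nat.add_le_add_right (hD v) _⟩

lemma pebblingStep_single {u v : V} (h : G.Adj u v) (C : V → ℕ) :
    PebblingStep G (C + Pi.single u 2) (C + Pi.single v 1) := by
  refine ⟨u, v, h, by simp, ?_⟩
  funext w
  rcases eq_or_ne w u with rfl | hu
  · simp [Pi.single_eq_of_ne h.ne]
  · rcases eq_or_ne w v with rfl | hv
    · simp [hu]
    · simp [hu, hv]

lemma Solvable.of_step {C C' D : V → ℕ} (h : PebblingStep G C C') (h' : Solvable G C' D) :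
    Solvable G C D := by
  obtain ⟨C'', hC, hD⟩ := h'
  exact ⟨C'', hC.head h, hD⟩

lemma Solvable.of_adj {u v : V} (h : G.Adj u v) {C D : V → ℕ}
    (h' : Solvable G (C + Pi.single v 1) D) : Solvable G (C + Pi.single u 2) D :=
  h'.of_step (pebblingStep_single h C)

lemma single_one_add_single_one (v : V) :
    (Pi.single v 1 + Pi.single v 1 : V → ℕ) = Pi.single v 2 := by
  rw [← Pi.single_add]

lemma exists_eq_add_single {C : V → ℕ} {v : V} {k : ℕ} (h : k ≤ C v) :
    ∃ C' : V → ℕ, C = C' + Pi.single v k := by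
  refine ⟨C - Pi.single v k, (tsub_add_cancel_of_le fun w => ?_).symm⟩
  rcases eq_or_ne w v with rfl | hw <;> simp [*]

/-- One pair of pebbles on `v` and one pebble on `w` serve `r` along the path `v, w, r`. -/
lemma Solvable.of_path_two {v w r : V} (hvw : G.Adj v w) (hwr : G.Adj w r) {C D : V → ℕ}
    (h : Solvable G C D) :
    Solvable G (C + Pi.single w 1 + Pi.single v 2) (D + Pi.single r 1) := by
  refine Solvable.of_adj hvw ?_
  rw [add_assoc, single_one_add_single_one]
  exact Solvable.of_adj hwr (h.add _)

lemma Solvable.of_path_three {v x y r : V} (hvx : G.Adj v x) (hxy : G.Adj x y)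
    (hyr : G.Adj y r) {C D : V → ℕ} (h : Solvable G C D) :
    Solvable G (C + Pi.single y 1 + Pi.single x 1 + Pi.single v 2) (D + Pi.single r 1) := by
  refine Solvable.of_adj hvx ?_
  rw [add_assoc, single_one_add_single_one]
  exact h.of_path_two hxy hyr

/-- Two pairs of pebbles on neighbours of `w` serve `r` through `w`. -/
lemma Solvable.of_two_pairs {u v w r : V} (huw : G.Adj u w) (hvw : G.Adj v w)
    (hwr : G.Adj w r) {C D : V → ℕ} (h : Solvable G C D) :
    Solvable G (C + Pi.single v 2 + Pi.single u 2) (D + Pi.single r 1) := by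
  refine Solvable.of_adj huw ?_
  rw [add_right_comm]
  exact h.of_path_two hvw hwr

variable [Fintype V]

lemma solvable_of_sum_eq_zero {C D : V → ℕ} (h : ∑ v, D v = 0) : Solvable G C D :=
  ⟨C, .refl, fun v => by
    have := (Finset.sum_eq_zero_iff.mp h) v (Finset.mem_univ v)
    omega⟩

lemma exists_target {D : V → ℕ} {t : ℕ} (h : ∑ v, D v = t + 1) :
    ∃ (r : V) (D' : V → ℕ), D = D' + Pi.single r 1 ∧ ∑ v, D' v = t := by
  obtain ⟨r, -, hr⟩ := Finset.exists_ne_zero_of_sum_ne_zero (h.trans_ne t.succ_ne_zero)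
  obtain ⟨D', rfl⟩ := exists_eq_add_single (Nat.one_le_iff_ne_zero.mpr hr)
  refine ⟨r, D', rfl, ?_⟩
  simpa [Finset.sum_add_distrib] using h

lemma pairCount_add_single (C : V → ℕ) (v : V) (k : ℕ) :
    pairCount (C + Pi.single v k) + C v / 2 = pairCount C + (C v + k) / 2 := by
  unfold pairCount
  rw [← Finset.add_sum_erase _ _ (Finset.mem_univ v),
    ← Finset.add_sum_erase _ (fun x => C x / 2) (Finset.mem_univ v)]
  have : ∑ x ∈ Finset.univ.erase v, (C + Pi.single v k : V → ℕ) x / 2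
      = ∑ x ∈ Finset.univ.erase v, C x / 2 :=
    Finset.sum_congr rfl fun x hx => by simp [Finset.ne_of_mem_erase hx]
  rw [this]
  simp only [Pi.add_apply, Pi.single_eq_same]
  omega

lemma pairCount_add_single_two (C : V → ℕ) (v : V) :
    pairCount (C + Pi.single v 2) = pairCount C + 1 := by
  have := pairCount_add_single C v 2
  omega

lemma pairCount_add_single_one_le (C : V → ℕ) (v : V) :
    pairCount (C + Pi.single v 1) ≤ pairCount C + 1 := by
  have := pairCount_add_single C v 1
  omega

lemma pairCount_add_single_one_of_even {C : V → ℕ} {v : V} (h : Even (C v)) :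
    pairCount (C + Pi.single v 1) = pairCount C := by
  have := pairCount_add_single C v 1
  obtain ⟨k, hk⟩ := h
  omega

lemma sum_add_single (C : V → ℕ) (v : V) (k : ℕ) :
    ∑ x, (C + Pi.single v k : V → ℕ) x = ∑ x, C x + k := by
  simp [Finset.sum_add_distrib]

/-- If any two non-neighbours of a vertex have a neighbour in common with it, then two pairs of
pebbles for each unit of demand suffice. -/
lemma solvable_of_two_mul_le_pairCount
    (hG : ∀ u v r : V, ¬ G.Adj u r → ¬ G.Adj v r → u ≠ r → v ≠ r →
      ∃ w, G.Adj u w ∧ G.Adj v w ∧ G.Adj w r)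
    (t : ℕ) (C D : V → ℕ) (hD : ∑ v, D v = t) (hC : 2 * t ≤ pairCount C) :
    Solvable G C D := by
  induction t generalizing C D with
  | zero => exact solvable_of_sum_eq_zero hD
  | succ t ih =>
    obtain ⟨r, D', rfl, hD'⟩ := exists_target hD
    by_cases hr : 1 ≤ C r
    · obtain ⟨C', rfl⟩ := exists_eq_add_single hr
      have := pairCount_add_single_one_le C' r
      exact (ih C' D' hD' (by omega)).add _
    by_cases hb : ∃ v, 2 ≤ C v ∧ G.Adj v r
    · obtain ⟨v, hv, hvr⟩ := hb
      obtain ⟨C', rfl⟩ := exists_eq_add_single hv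
      have := pairCount_add_single_two C' v
      exact Solvable.of_adj hvr ((ih C' D' hD' (by omega)).add _)
    push Not at hb
    obtain ⟨u, hu⟩ := exists_two_le (C := C) (by omega)
    have hur : u ≠ r := by rintro rfl; omega
    have hur' := hb u hu
    obtain ⟨C', rfl⟩ := exists_eq_add_single hu
    have h1 := pairCount_add_single_two C' u
    obtain ⟨v, hv⟩ := exists_two_le (C := C') (by omega)
    have hv' : 2 ≤ (C' + Pi.single u 2 : V → ℕ) v := hv.trans (Nat.le_add_right _ _)
    have hvr : v ≠ r := by rintro rfl; omega
    have hvr' := hb v hv'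
    obtain ⟨C'', rfl⟩ := exists_eq_add_single hv
    have h2 := pairCount_add_single_two C'' v
    obtain ⟨w, huw, hvw, hwr⟩ := hG u v r hur' hvr' hur hvr
    exact (ih C'' D' hD' (by omega)).of_two_pairs huw hvw hwr

end Pebbling

section Kneser

variable {m : ℕ}

lemma kneserGraph_two_adj {a b : {s : Finset (Fin m) // s.card = 2}} :
    (kneserGraph m 2).Adj a b ↔ Disjoint a.1 b.1 := by
  rw [kneserGraph, SimpleGraph.fromRel_adj, disjoint_comm (a := b.1), or_self]
  refine ⟨And.right, fun h => ⟨?_, h⟩⟩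
  rintro rfl
  have := a.2
  simp [disjoint_self.mp h] at this

lemma exists_eq_pair {s : Finset (Fin m)} (hs : s.card = 2) {a : Fin m} (ha : a ∈ s) :
    ∃ b, a ≠ b ∧ s = {a, b} := by
  obtain ⟨x, y, hxy, rfl⟩ := Finset.card_eq_two.mp hs
  rcases Finset.mem_insert.mp ha with rfl | h
  · exact ⟨y, hxy, rfl⟩
  · rw [Finset.mem_singleton] at h
    subst h
    exact ⟨x, hxy.symm, Finset.pair_comm _ _⟩

lemma exists_eq_pairs {r v : {s : Finset (Fin m) // s.card = 2}} (hne : r ≠ v)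
    (h : ¬ (kneserGraph m 2).Adj r v) :
    ∃ a b c, a ≠ b ∧ a ≠ c ∧ b ≠ c ∧ r.1 = {a, b} ∧ v.1 = {a, c} := by
  rw [kneserGraph_two_adj, Finset.not_disjoint_iff] at h
  obtain ⟨a, har, hav⟩ := h
  obtain ⟨b, hab, hr⟩ := exists_eq_pair r.2 har
  obtain ⟨c, hac, hv⟩ := exists_eq_pair v.2 hav
  refine ⟨a, b, c, hab, hac, ?_, hr, hv⟩
  rintro rfl
  exact hne (Subtype.ext (hr.trans hv.symm))

lemma exists_common_neighbor (hm : 5 < m) (u v r : {s : Finset (Fin m) // s.card = 2})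
    (hu : ¬ (kneserGraph m 2).Adj u r) (hv : ¬ (kneserGraph m 2).Adj v r)
    (hur : u ≠ r) (hvr : v ≠ r) :
    ∃ w, (kneserGraph m 2).Adj u w ∧ (kneserGraph m 2).Adj v w ∧ (kneserGraph m 2).Adj w r := by
  obtain ⟨a, b, c, -, -, -, hu1, hr1⟩ := exists_eq_pairs hur hu
  obtain ⟨d, e, f, -, -, -, hv1, hr2⟩ := exists_eq_pairs hvr hv
  have hsub : u.1 ∪ v.1 ∪ r.1 ⊆ insert b (insert e r.1) := by
    have ha : a ∈ r.1 := by simp [hr1]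
    have hd : d ∈ r.1 := by simp [hr2]
    rw [hu1, hv1]
    grind
  have hcard : (u.1 ∪ v.1 ∪ r.1).card ≤ 4 := by
    have h1 := Finset.card_le_card hsub
    have h2 := Finset.card_insert_le b (insert e r.1)
    have h3 := Finset.card_insert_le e r.1
    have h4 := r.2
    omega
  have hcompl : 2 ≤ ((u.1 ∪ v.1 ∪ r.1)ᶜ).card := by
    rw [Finset.card_compl, Fintype.card_fin]
    omega
  obtain ⟨w, hw, hw2⟩ := Finset.exists_subset_card_eq hcompl
  have hdis : Disjoint (u.1 ∪ v.1 ∪ r.1) w :=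
    Finset.disjoint_of_subset_right hw disjoint_compl_right
  rw [Finset.disjoint_union_left, Finset.disjoint_union_left] at hdis
  refine ⟨⟨w, hw2⟩, ?_, ?_, ?_⟩ <;> rw [kneserGraph_two_adj]
  exacts [hdis.1.1, hdis.1.2, hdis.2.symm]

/-- The neighbourhood of `v` in `K(m, 2)`. -/
def kneserNeighbors (v : {s : Finset (Fin m) // s.card = 2}) :
    Finset {s : Finset (Fin m) // s.card = 2} :=
  Finset.univ.filter fun w => Disjoint v.1 w.1

lemma mem_kneserNeighbors {v w : {s : Finset (Fin m) // s.card = 2}} :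
    w ∈ kneserNeighbors v ↔ (kneserGraph m 2).Adj v w := by
  simp [kneserNeighbors, kneserGraph_two_adj]

lemma card_kneserNeighbors (v : {s : Finset (Fin m) // s.card = 2}) :
    (kneserNeighbors v).card = (m - 2).choose 2 := by
  have hc : (v.1ᶜ).card = m - 2 := by rw [Finset.card_compl, Fintype.card_fin, v.2]
  rw [← hc, ← Finset.card_powersetCard]
  refine Finset.card_bij (fun w _ => w.1) ?_ ?_ ?_
  · intro w hw
    rw [mem_kneserNeighbors, kneserGraph_two_adj] at hw
    rw [Finset.mem_powersetCard]
    exact ⟨Finset.subset_compl_iff_disjoint_left.mpr hw, w.2⟩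
  · intro w _ w' _ h
    exact Subtype.ext h
  · intro s hs
    rw [Finset.mem_powersetCard] at hs
    refine ⟨⟨s, hs.2⟩, ?_, rfl⟩
    rw [mem_kneserNeighbors, kneserGraph_two_adj]
    exact Finset.subset_compl_iff_disjoint_left.mp hs.1

lemma adj_of_not_adj {r v x x' y : {s : Finset (Fin m) // s.card = 2}} (hne : r ≠ v)
    (hrv : ¬ (kneserGraph m 2).Adj r v)
    (hy : (kneserGraph m 2).Adj r y) (hy' : ¬ (kneserGraph m 2).Adj v y)
    (hx : (kneserGraph m 2).Adj v x) (hx' : ¬ (kneserGraph m 2).Adj r x)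
    (hz : (kneserGraph m 2).Adj v x') (hz' : ¬ (kneserGraph m 2).Adj r x')
    (hxx : x' ≠ x) (hxy : ¬ (kneserGraph m 2).Adj x y) : (kneserGraph m 2).Adj x' y := by
  obtain ⟨a, b, c, hab, hac, hbc, hr1, hv1⟩ := exists_eq_pairs hne hrv
  simp only [kneserGraph_two_adj, hr1, hv1] at *
  have hbx : b ∈ x.1 := by
    simp at hx hx'; tauto
  have hbz : b ∈ x'.1 := by
    simp at hz hz'; tauto
  have hcy : c ∈ y.1 := by
    simp at hy hy'; tauto
  obtain ⟨i, hi, hx1⟩ := exists_eq_pair x.2 hbx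
  obtain ⟨j, hj, hz1⟩ := exists_eq_pair x'.2 hbz
  obtain ⟨k, hk, hy1⟩ := exists_eq_pair y.2 hcy
  have hij : j ≠ i := by
    rintro rfl
    exact hxx (Subtype.ext (hz1.trans hx1.symm))
  rw [hx1] at hx hxy
  rw [hz1] at hz ⊢
  rw [hy1] at hy hxy ⊢
  simp at *
  grind

lemma exists_second_neighbor (hm : 5 < m) {r v y : {s : Finset (Fin m) // s.card = 2}}
    (hne : r ≠ v) (hrv : ¬ (kneserGraph m 2).Adj r v) :
    ∃ y', y' ≠ y ∧ (kneserGraph m 2).Adj r y' ∧ ¬ (kneserGraph m 2).Adj v y' := by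
  obtain ⟨a, b, c, hab, hac, hbc, hr1, hv1⟩ := exists_eq_pairs hne hrv
  have hcard : (insert a (insert b (insert c y.1))).card ≤ 5 := by
    have h1 := Finset.card_insert_le a (insert b (insert c y.1))
    have h2 := Finset.card_insert_le b (insert c y.1)
    have h3 := Finset.card_insert_le c y.1
    have h4 := y.2
    omega
  obtain ⟨d, hd⟩ : ∃ d, d ∉ insert a (insert b (insert c y.1)) := by
    by_contra! h
    have := Finset.card_le_card (fun d _ => h d : Finset.univ ⊆ _)
    simp only [Finset.card_univ, Fintype.card_fin] at this
    omega
  simp only [Finset.mem_insert, not_or] at hd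
  obtain ⟨hda, hdb, hdc, hdy⟩ := hd
  refine ⟨⟨{c, d}, Finset.card_pair (Ne.symm hdc)⟩, ?_, ?_, ?_⟩
  · rintro rfl
    simp at hdy
  · rw [kneserGraph_two_adj, hr1]
    simp
    grind
  · rw [kneserGraph_two_adj, hv1]
    simp

lemma card_le_card_even (hm : 5 < m) {C : {s : Finset (Fin m) // s.card = 2} → ℕ}
    {r v : {s : Finset (Fin m) // s.card = 2}} (hne : r ≠ v)
    (hrv : ¬ (kneserGraph m 2).Adj r v) (hr : Even (C r))
    (hA : ∀ w, (kneserGraph m 2).Adj v w → (kneserGraph m 2).Adj r w → Even (C w))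
    (hXY : ∀ x y, (kneserGraph m 2).Adj v x → (kneserGraph m 2).Adj x y →
      (kneserGraph m 2).Adj r y → Even (C x) ∨ Even (C y)) :
    (m - 2).choose 2 + 1 ≤ (Finset.univ.filter fun w => Even (C w)).card := by
  have hrr : r ∉ kneserNeighbors r := by simp [mem_kneserNeighbors]
  have hrv' : r ∉ kneserNeighbors v := by
    rw [mem_kneserNeighbors]; exact fun h => hrv h.symm
  by_cases h1 : ∀ y, (kneserGraph m 2).Adj r y → Even (C y)
  · rw [← card_kneserNeighbors r, ← Finset.card_insert_of_notMem hrr]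
    refine Finset.card_le_card fun w hw => ?_
    rcases Finset.mem_insert.mp hw with rfl | hw
    · simpa using hr
    · simpa using h1 w (mem_kneserNeighbors.mp hw)
  by_cases h2 : ∀ x, (kneserGraph m 2).Adj v x → Even (C x)
  · rw [← card_kneserNeighbors v, ← Finset.card_insert_of_notMem hrv']
    refine Finset.card_le_card fun w hw => ?_
    rcases Finset.mem_insert.mp hw with rfl | hw
    · simpa using hr
    · simpa using h2 w (mem_kneserNeighbors.mp hw)
  push Not at h1 h2
  obtain ⟨y, hry, hy⟩ := h1
  obtain ⟨x, hvx, hx⟩ := h2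
  have hvy : ¬ (kneserGraph m 2).Adj v y := fun h => hy (hA y h hry)
  have hrx : ¬ (kneserGraph m 2).Adj r x := fun h => hx (hA x hvx h)
  have hxy : ¬ (kneserGraph m 2).Adj x y := fun h => by
    rcases hXY x y hvx h hry with h | h
    · exact hx h
    · exact hy h
  have hx' : ∀ x', (kneserGraph m 2).Adj v x' → x' ≠ x → Even (C x') := by
    intro x' hvx' hxx
    by_cases hrx' : (kneserGraph m 2).Adj r x'
    · exact hA x' hvx' hrx'
    · have := adj_of_not_adj hne hrv hry hvy hvx hrx hvx' hrx' hxx hxy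
      exact (hXY x' y hvx' this hry).resolve_right (hy)
  obtain ⟨z, hzy, hrz, hvz⟩ := exists_second_neighbor hm (y := y) hne hrv
  have hz : Even (C z) := by
    have hyz := adj_of_not_adj hne.symm (fun h => hrv h.symm) hvx hrx hry hvy hrz hvz hzy
      (fun h => hxy h.symm)
    exact (hXY x z hvx hyz.symm hrz).resolve_left (hx)
  have hcard : (insert r (insert z ((kneserNeighbors v).erase x))).card
      = (m - 2).choose 2 + 1 := by
    have hzmem : z ∉ (kneserNeighbors v).erase x := by
      simp [mem_kneserNeighbors, hvz]
    have hrmem : r ∉ insert z ((kneserNeighbors v).erase x) := by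
      simp only [Finset.mem_insert, Finset.mem_erase, not_or, not_and]
      exact ⟨hrz.ne, fun _ => hrv'⟩
    have hxmem := mem_kneserNeighbors.mpr hvx
    rw [Finset.card_insert_of_notMem hrmem, Finset.card_insert_of_notMem hzmem,
      Finset.card_erase_add_one hxmem, card_kneserNeighbors]
  rw [← hcard]
  refine Finset.card_le_card fun w hw => ?_
  simp only [Finset.mem_insert, Finset.mem_erase, mem_kneserNeighbors] at hw
  rw [Finset.mem_filter]
  refine ⟨Finset.mem_univ _, ?_⟩
  rcases hw with rfl | rfl | ⟨hwx, hvw⟩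
  exacts [hr, hz, hx' w hvw hwx]

lemma choose_two_eq (hm : 5 < m) : m.choose 2 + 3 = (m - 2).choose 2 + 2 * m := by
  obtain ⟨k, rfl⟩ : ∃ k, m = k + 2 := ⟨m - 2, by omega⟩
  have h1 := Nat.choose_succ_succ' (k + 1) 1
  have h2 := Nat.choose_succ_succ' k 1
  simp only [Nat.choose_one_right, Nat.reduceAdd, add_assoc, Nat.add_sub_cancel] at *
  omega

lemma card_pairs : Fintype.card {s : Finset (Fin m) // s.card = 2} = m.choose 2 := by
  simp

/-- In `K(m, 2)`, a configuration with at least as many pairs of pebbles as the demand `t`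
and with at least `4t + 2m - 5` pebbles solves the demand. -/
lemma solvable_of_le_pairCount (hm : 5 < m) (t : ℕ)
    (C D : {s : Finset (Fin m) // s.card = 2} → ℕ) (hD : ∑ v, D v = t)
    (hP : t ≤ pairCount C) (hC : 4 * t + 2 * m ≤ ∑ v, C v + 5) :
    Solvable (kneserGraph m 2) C D := by
  induction t generalizing C D with
  | zero => exact solvable_of_sum_eq_zero hD
  | succ t ih =>
    obtain ⟨r, D', rfl, hD'⟩ := exists_target hD
    by_cases hr : 1 ≤ C r
    · obtain ⟨C', rfl⟩ := exists_eq_add_single hr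
      have := pairCount_add_single_one_le C' r
      rw [sum_add_single] at hC
      exact (ih C' D' hD' (by omega) (by omega)).add _
    have hr0 : C r = 0 := by omega
    by_cases hb : ∃ v, 2 ≤ C v ∧ (kneserGraph m 2).Adj v r
    · obtain ⟨v, hv, hvr⟩ := hb
      obtain ⟨C', rfl⟩ := exists_eq_add_single hv
      have := pairCount_add_single_two C' v
      rw [sum_add_single] at hC
      exact Solvable.of_adj hvr ((ih C' D' hD' (by omega) (by omega)).add _)
    push Not at hb
    have hle : ∀ w, (kneserGraph m 2).Adj r w → C w ≤ 1 := fun w hw => by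
      by_contra! h
      exact hb w h hw.symm
    by_cases hA : ∃ v w, 2 ≤ C v ∧ (kneserGraph m 2).Adj v w ∧ (kneserGraph m 2).Adj r w ∧
        Odd (C w)
    · obtain ⟨v, w, hv, hvw, hrw, hw⟩ := hA
      have hw1 : C w = 1 := le_antisymm (hle w hrw) hw.pos
      obtain ⟨C₁, rfl⟩ := exists_eq_add_single hv
      simp only [Pi.add_apply, Pi.single_eq_of_ne hvw.ne', add_zero] at hw1
      obtain ⟨C₂, rfl⟩ := exists_eq_add_single hw1.ge
      have h1 := pairCount_add_single_two (C₂ + Pi.single w 1) v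
      have h2 := pairCount_add_single_one_of_even (C := C₂) (v := w) (by simp at hw1; simp [hw1])
      rw [sum_add_single, sum_add_single] at hC
      exact (ih C₂ D' hD' (by omega) (by omega)).of_path_two hvw hrw.symm
    push Not at hA
    obtain ⟨v, hv⟩ := exists_two_le (C := C) (by omega)
    have hrv : ¬ (kneserGraph m 2).Adj r v := fun h => hb v hv h.symm
    have hne : r ≠ v := by rintro rfl; omega
    by_cases hXY : ∃ x y, (kneserGraph m 2).Adj v x ∧ (kneserGraph m 2).Adj x y ∧
        (kneserGraph m 2).Adj r y ∧ Odd (C x) ∧ Odd (C y)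
    · obtain ⟨x, y, hvx, hxy, hry, hx, hy⟩ := hXY
      have hx1 : C x = 1 := by
        have := hx.pos
        by_contra hx1
        exact hA x y (by omega) hxy hry hy
      have hy1 : C y = 1 := le_antisymm (hle y hry) hy.pos
      have hvy : v ≠ y := by rintro rfl; omega
      obtain ⟨C₁, rfl⟩ := exists_eq_add_single hv
      simp only [Pi.add_apply, Pi.single_eq_of_ne hvx.ne', Pi.single_eq_of_ne hvy.symm,
        add_zero] at hx1 hy1
      obtain ⟨C₂, rfl⟩ := exists_eq_add_single hx1.ge
      simp only [Pi.add_apply, Pi.single_eq_of_ne hxy.ne', Pi.single_eq_same, add_zero] at hx1 hy1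
      obtain ⟨C₃, rfl⟩ := exists_eq_add_single hy1.ge
      have h1 := pairCount_add_single_two (C₃ + Pi.single y 1 + Pi.single x 1) v
      have h2 := pairCount_add_single_one_of_even (C := C₃ + Pi.single y 1) (v := x)
        (by rw [Nat.add_eq_right.mp hx1]; exact Even.zero)
      have h3 := pairCount_add_single_one_of_even (C := C₃) (v := y)
        (by simp at hy1; simp [hy1])
      rw [sum_add_single, sum_add_single, sum_add_single] at hC
      exact (ih C₃ D' hD' (by omega) (by omega)).of_path_three hvx hxy hry.symm
    push Not at hXY
    have hEven := card_le_card_even hm (C := C) hne hrv (by simp [hr0])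
      (fun w hvw hrw => Nat.not_odd_iff_even.mp (hA v w hv hvw hrw)) (fun x y hvx hxy hry => by
        rcases Nat.even_or_odd (C x) with h | h
        · exact Or.inl h
        · exact Or.inr (Nat.not_odd_iff_even.mp (hXY x y hvx hxy hry h)))
    have hsum := sum_add_card_even C
    have hch := choose_two_eq hm
    rw [card_pairs] at hsum
    exact solvable_of_two_mul_le_pairCount (exists_common_neighbor hm) (t + 1) C _ hD (by omega)

lemma solvable_of_sum_eq_max (hm : 5 < m) (C D : {s : Finset (Fin m) // s.card = 2} → ℕ) (t : ℕ)
    (ht : 1 ≤ t) (hD : ∑ v, D v = t)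
    (hC : ∑ v, C v = max (m.choose 2 + 2 * t - 2) (4 * t + 2 * m - 5)) :
    Solvable (kneserGraph m 2) C D := by
  have h1 : m.choose 2 + 2 * t - 2 ≤ ∑ v, C v := hC ▸ le_max_left _ _
  have h2 : 4 * t + 2 * m - 5 ≤ ∑ v, C v := hC ▸ le_max_right _ _
  have hsum := sum_add_card_even C
  rw [card_pairs] at hsum
  by_cases hP : t ≤ pairCount C
  · exact solvable_of_le_pairCount hm t C D hD hP (by omega)
  obtain ⟨t, rfl⟩ : ∃ k, t = k + 1 := ⟨t - 1, by omega⟩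
  obtain ⟨r, D', rfl, hD'⟩ := exists_target hD
  have hodd : Odd (C r) := by
    rw [← Nat.not_even_iff_odd]
    intro h
    have : 0 < (Finset.univ.filter fun v => Even (C v)).card :=
      Finset.card_pos.mpr ⟨r, by simpa using h⟩
    omega
  obtain ⟨C', rfl⟩ := exists_eq_add_single (C := C) (v := r) (k := 1) hodd.pos
  have hev : Even (C' r) := by
    simp only [Pi.add_apply, Pi.single_eq_same] at hodd
    simpa [Nat.odd_add_one] using hodd
  have := pairCount_add_single_one_of_even hev
  rw [sum_add_single] at h1 h2 hsum
  exact (solvable_of_le_pairCount hm t C' D' hD' (by omega) (by omega)).add _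

end Kneser

theorem kneser_target_upper (m : ℕ) (hm : 5 < m)
    (D : {s : Finset (Fin m) // s.card = 2} → ℕ)
    (t : ℕ) (ht : 1 ≤ t) (hD : ∑ v, D v = t) :
    pebblingNumber (kneserGraph m 2) D ≤ max (m.choose 2 + 2 * t - 2) (4 * t + 2 * m - 5) ∧
    ∀ C : {s : Finset (Fin m) // s.card = 2} → ℕ,
      (∑ v, C v) = max (m.choose 2 + 2 * t - 2) (4 * t + 2 * m - 5) →
        Solvable (kneserGraph m 2) C D := by
  have h := fun C hC => solvable_of_sum_eq_max hm C D t ht hD hC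
  exact ⟨Nat.sInf_le h, h⟩
end
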